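/- Let a ∈ ℂ with Re(a) < −1. For coprime integers b, q with 1 ≤ b ≤ q, define the generalized cotangent sum c_a(b/q) := q^a·Σ_{m=1}^{q−1} cot(πmb/q)·ζ(−a, m/q) (an empty sum, hence 0, when q = 1), where ζ(s, x) := Σ_{n≥0} (n + x)^{−s} is the Hurwitz zeta function (here Re(−a) > 1, so the series converges) and q^a := exp(a·log q). Then there exists a Lebesgue-measurable function F : [0,1] → ℂ such that: (a) for every bounded continuous G : ℂ → ℝ, (1/φ(q))·Σ_{b=1, gcd(b,q)=1}^{q} G(c_a(b/q)) → ∫_{[0,1]} G(F(x)) dx as q → ∞, where φ is Euler's totient function; (b) if a ∈ ℝ, then F(x) ∈ ℝ for Lebesgue-almost every x ∈ [0,1], and for every c ∈ ℂ the set {x ∈ [0,1] : F(x) = c} has Lebesgue measure zero; (c) if a ∉ ℝ, then for every nonzero ℝ-linear map φ : ℂ → ℝ and every c ∈ ℝ, the set {x ∈ [0,1] : φ(F(x)) = c} has Lebesgue measure zero. -/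

import Mathlib

open Filter Topology MeasureTheory Set

/-- The Hurwitz zeta function `ζ(s, x) = Σ_{n≥0} (n + x)^{-s}`, defined by its series
(absolutely convergent for `Re s > 1` and `x ∈ (0,1]`). -/
noncomputable def hzetaSeries (s : ℂ) (x : ℝ) : ℂ := ∑' n : ℕ, ((n : ℂ) + (x : ℂ)) ^ (-s)

/-- The generalized cotangent sum
`c_a(b/q) = q^a Σ_{m=1}^{q-1} cot(πmb/q) ζ(-a, m/q)`. -/
noncomputable def cotanSum (a : ℂ) (b q : ℕ) : ℂ :=
  ((q : ℝ) : ℂ) ^ a * ∑ m ∈ Finset.Ico 1 q,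
    ((Real.cot (Real.pi * m * b / q) : ℝ) : ℂ) * hzetaSeries (-a) ((m : ℝ) / q)

lemma two_pow_card_primeFactors_le {δ : ℝ} (hδ : 0 < δ) :
    ∃ C : ℝ, 0 < C ∧ ∀ q : ℕ, q ≠ 0 → (2 : ℝ) ^ q.primeFactors.card ≤ C * (q : ℝ) ^ δ := by
  obtain ⟨N, hN⟩ := exists_nat_ge ((2 : ℝ) ^ δ⁻¹)
  refine ⟨2 ^ N, by positivity, fun q hq ↦ ?_⟩
  have hterm : ∀ p ∈ q.primeFactors, (2 : ℝ) ≤ (if p < N then 2 else 1) * (p : ℝ) ^ δ := by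
    intro p hp
    have hp1 : (1 : ℝ) ≤ p := by exact_mod_cast (Nat.prime_of_mem_primeFactors hp).one_le
    split_ifs with h
    · linarith [Real.one_le_rpow hp1 hδ.le]
    · rw [one_mul]
      have h2 : (2 : ℝ) ^ δ⁻¹ ≤ p := hN.trans (by exact_mod_cast not_lt.mp h)
      calc (2 : ℝ) = ((2 : ℝ) ^ δ⁻¹) ^ δ := by
            rw [← Real.rpow_mul (by norm_num), inv_mul_cancel₀ hδ.ne', Real.rpow_one]
        _ ≤ _ := Real.rpow_le_rpow (by positivity) h2 hδ.le
  calc (2 : ℝ) ^ q.primeFactors.card = ∏ _p ∈ q.primeFactors, (2 : ℝ) := by simp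
    _ ≤ ∏ p ∈ q.primeFactors, (if p < N then 2 else 1) * (p : ℝ) ^ δ :=
        Finset.prod_le_prod (fun _ _ ↦ by norm_num) hterm
    _ = 2 ^ (q.primeFactors.filter (· < N)).card * (∏ p ∈ q.primeFactors, (p : ℝ)) ^ δ := by
        rw [Finset.prod_mul_distrib, Finset.prod_ite, Real.finsetProd_rpow _ _ (by simp)]
        simp
    _ ≤ 2 ^ N * (q : ℝ) ^ δ := by
        gcongr
        · norm_num
        · calc _ ≤ (Finset.range N).card := Finset.card_le_card fun p hp ↦ by
                simpa using (Finset.mem_filter.mp hp).2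
            _ = N := by simp
        · have := Nat.le_of_dvd (Nat.pos_of_ne_zero hq) (Nat.prod_primeFactors_dvd q)
          rw [← Nat.cast_prod]
          exact_mod_cast this

lemma le_two_pow_card_primeFactors_mul_totient (q : ℕ) :
    (q : ℝ) ≤ 2 ^ q.primeFactors.card * q.totient := by
  have h := Nat.totient_eq_mul_prod_factors q
  have h' : (q.totient : ℝ) = q * ∏ p ∈ q.primeFactors, (1 - (p : ℝ)⁻¹) := by
    have := congrArg (Rat.cast : ℚ → ℝ) h
    push_cast at this
    exact this
  have h2 : ∏ _p ∈ q.primeFactors, (2 : ℝ)⁻¹ ≤ ∏ p ∈ q.primeFactors, (1 - (p : ℝ)⁻¹) := by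
    refine Finset.prod_le_prod (fun _ _ ↦ by norm_num) fun p hp ↦ ?_
    have : (2 : ℝ) ≤ p := by exact_mod_cast (Nat.prime_of_mem_primeFactors hp).two_le
    have := inv_anti₀ (by norm_num) this
    linarith
  rw [Finset.prod_const] at h2
  rw [h']
  calc (q : ℝ) = 2 ^ q.primeFactors.card * (q * 2⁻¹ ^ q.primeFactors.card) := by
        rw [inv_pow]; field_simp
    _ ≤ _ := by gcongr

lemma tendsto_rpow_mul_two_pow_div_totient {p : ℝ} (hp : p < 1) :
    Tendsto (fun q : ℕ ↦ (q : ℝ) ^ p * 2 ^ q.primeFactors.card / q.totient) atTop (𝓝 0) := by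
  obtain ⟨C, hC, h⟩ := two_pow_card_primeFactors_le (δ := (1 - p) / 4) (by linarith)
  have hlim : Tendsto (fun q : ℕ ↦ C ^ 2 * (q : ℝ) ^ (-((1 - p) / 2))) atTop (𝓝 0) := by
    simpa using ((tendsto_rpow_neg_atTop (by linarith : 0 < (1 - p) / 2)).comp
      tendsto_natCast_atTop_atTop).const_mul (C ^ 2)
  refine tendsto_of_tendsto_of_tendsto_of_le_of_le' tendsto_const_nhds hlim
    (.of_forall fun q ↦ by positivity) ?_
  filter_upwards [eventually_ge_atTop 1] with q hq
  have hq0 : (0 : ℝ) < q := by exact_mod_cast hq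
  have hφ : (0 : ℝ) < q.totient := by exact_mod_cast Nat.totient_pos.mpr hq
  rw [div_le_iff₀ hφ]
  have h1 := le_two_pow_card_primeFactors_mul_totient q
  have h2 := h q (by omega)
  set W : ℝ := 2 ^ q.primeFactors.card
  have hW : 0 < W := by positivity
  have hqφ : (q : ℝ) / W ≤ q.totient := by rw [div_le_iff₀ hW]; linarith
  calc (q : ℝ) ^ p * W = (q : ℝ) ^ p * W ^ 2 / q * (q / W) := by field_simp
    _ ≤ (q : ℝ) ^ p * (C * (q : ℝ) ^ ((1 - p) / 4)) ^ 2 / q * q.totient := by gcongr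
    _ = C ^ 2 * ((q : ℝ) ^ p * ((q : ℝ) ^ ((1 - p) / 4)) ^ 2 * (q : ℝ) ^ (-1 : ℝ)) * q.totient := by
        rw [Real.rpow_neg_one]; field_simp
    _ = C ^ 2 * (q : ℝ) ^ (-((1 - p) / 2)) * q.totient := by
        rw [← Real.rpow_mul_natCast hq0.le, ← Real.rpow_add hq0, ← Real.rpow_add hq0]
        congr 3; push_cast; ring

open ArithmeticFunction in
lemma sum_coprime_eq_sum_moebius (f : ℕ → ℝ) {q : ℕ} (hq : q ≠ 0) :
    ∑ b ∈ (Finset.Icc 1 q).filter (fun b ↦ Nat.Coprime b q), f b =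
      ∑ d ∈ q.divisors, (moebius d : ℝ) * ∑ j ∈ Finset.Icc 1 (q / d), f (d * j) := by
  have hind : ∀ n : ℕ, n ≠ 0 → ∑ d ∈ n.divisors, (moebius d : ℝ) = if n = 1 then 1 else 0 := by
    intro n _
    have := congrArg (fun g : ArithmeticFunction ℝ ↦ g n) (coe_moebius_mul_coe_zeta (R := ℝ))
    simpa only [coe_mul_zeta_apply, one_apply, intCoe_apply] using this
  have hinner : ∀ d ∈ q.divisors, ∑ j ∈ Finset.Icc 1 (q / d), f (d * j) =
      ∑ b ∈ Finset.Icc 1 q, if d ∣ b then f b else 0 := by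
    intro d hd
    have hdq := Nat.dvd_of_mem_divisors hd
    have hd0 : 0 < d := Nat.pos_of_mem_divisors hd
    rw [← Finset.sum_filter]
    refine Finset.sum_nbij (fun j ↦ d * j) ?_ ?_ ?_ (fun _ _ ↦ rfl)
    · intro j hj
      simp only [Finset.mem_Icc, Finset.mem_filter] at hj ⊢
      refine ⟨⟨Nat.mul_pos hd0 hj.1, ?_⟩, dvd_mul_right _ _⟩
      calc d * j ≤ d * (q / d) := Nat.mul_le_mul_left _ hj.2
        _ ≤ q := Nat.mul_div_le _ _
    · intro i _ j _ h
      exact Nat.eq_of_mul_eq_mul_left hd0 h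
    · intro b hb
      simp only [Finset.coe_filter, Finset.mem_Icc, mem_ofPred_eq] at hb
      obtain ⟨⟨h1, h2⟩, j, rfl⟩ := hb
      refine ⟨j, ?_, rfl⟩
      simp only [Finset.coe_Icc, mem_Icc]
      exact ⟨Nat.pos_of_ne_zero (by rintro rfl; simp at h1), (Nat.le_div_iff_mul_le hd0).mpr
        (by rwa [mul_comm])⟩
  have houter : ∑ d ∈ q.divisors, (moebius d : ℝ) * ∑ j ∈ Finset.Icc 1 (q / d), f (d * j) =
      ∑ d ∈ q.divisors, ∑ b ∈ Finset.Icc 1 q, (moebius d : ℝ) * if d ∣ b then f b else 0 :=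
    Finset.sum_congr rfl fun d hd ↦ by rw [hinner d hd, Finset.mul_sum]
  rw [Finset.sum_filter, houter, Finset.sum_comm]
  refine Finset.sum_congr rfl fun b hb ↦ ?_
  have hg : Nat.gcd b q ≠ 0 := Nat.gcd_ne_zero_right hq
  have : (Nat.gcd b q).divisors = q.divisors.filter (· ∣ b) := by
    ext d
    simp [Nat.dvd_gcd_iff, hq, and_comm]
  simp only [mul_ite, mul_zero]
  rw [← Finset.sum_filter, ← this, ← Finset.sum_mul, hind _ hg]
  simp [Nat.Coprime]

lemma sum_coprime_one {q : ℕ} :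
    ((Finset.Icc 1 q).filter (fun b ↦ Nat.Coprime b q)).card = q.totient := by
  rw [Nat.totient]
  rcases Nat.lt_or_ge q 2 with h | h
  · interval_cases q <;> simp
  · refine congrArg Finset.card (Finset.ext fun b ↦ ?_)
    simp only [Finset.mem_filter, Finset.mem_Icc, Finset.mem_range, Nat.coprime_comm (m := b)]
    constructor
    · rintro ⟨⟨h1, h2⟩, h3⟩
      refine ⟨lt_of_le_of_ne h2 ?_, h3⟩
      rintro rfl
      simp at h3; omega
    · rintro ⟨h1, h3⟩
      refine ⟨⟨Nat.pos_of_ne_zero ?_, h1.le⟩, h3⟩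
      rintro rfl
      simp at h3; omega

open ArithmeticFunction in
lemma sum_abs_moebius_divisors {q : ℕ} (hq : q ≠ 0) :
    ∑ d ∈ q.divisors, |(moebius d : ℝ)| = 2 ^ q.primeFactors.card := by
  have : ∀ d, |(moebius d : ℝ)| = if Squarefree d then 1 else 0 := by
    intro d
    have := abs_moebius (n := d)
    split_ifs at this ⊢ <;> exact_mod_cast this
  rw [Finset.sum_congr rfl fun d _ ↦ this d, ← Finset.sum_filter,
    Nat.sum_divisors_filter_squarefree hq]
  simp [UniqueFactorizationMonoid.primeFactors_eq_natPrimeFactors]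

/-- If the Riemann sums of `g` over `{j / n}` are `n * I` up to `O(n ^ p)` with `p < 1`, then the
averages of `g` over the reduced fractions with denominator `q` tend to `I`. -/
lemma tendsto_sum_coprime_div_totient {g : ℝ → ℝ} {I B p : ℝ} (hp0 : 0 ≤ p) (hp : p < 1)
    (hB : ∀ n : ℕ, n ≠ 0 → |∑ j ∈ Finset.Icc 1 n, g (j / n) - n * I| ≤ B * (n : ℝ) ^ p) :
    Tendsto (fun q : ℕ ↦ (∑ b ∈ (Finset.Icc 1 q).filter (fun b ↦ Nat.Coprime b q), g (b / q))
      / (q.totient : ℝ)) atTop (𝓝 I) := by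
  have hB0 : 0 ≤ B := by simpa using (abs_nonneg _).trans (hB 1 one_ne_zero)
  rw [tendsto_iff_norm_sub_tendsto_zero]
  refine squeeze_zero' (.of_forall fun _ ↦ norm_nonneg _) ?_
    (by simpa using (tendsto_rpow_mul_two_pow_div_totient hp).const_mul B)
  filter_upwards [eventually_ge_atTop 1] with q hq
  have hq0 : q ≠ 0 := by omega
  have hφ : (0 : ℝ) < q.totient := by exact_mod_cast Nat.totient_pos.mpr hq
  have hφs : (q.totient : ℝ) * I = ∑ d ∈ q.divisors,
      (ArithmeticFunction.moebius d : ℝ) * ((q / d : ℕ) * I) := by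
    have := sum_coprime_eq_sum_moebius (fun _ ↦ 1) hq0
    simp only [Finset.sum_const, Nat.card_Icc, nsmul_eq_mul, mul_one,
      Nat.add_sub_cancel, sum_coprime_one] at this
    rw [this, Finset.sum_mul]
    exact Finset.sum_congr rfl fun _ _ ↦ by ring
  have hsum := sum_coprime_eq_sum_moebius (fun b ↦ g (b / q)) hq0
  rw [Real.norm_eq_abs, div_sub' hφ.ne', abs_div, abs_of_pos hφ, hφs, hsum,
    ← Finset.sum_sub_distrib, ← mul_div_assoc]
  gcongr
  calc _ ≤ ∑ d ∈ q.divisors, |(ArithmeticFunction.moebius d : ℝ)| * (B * (q : ℝ) ^ p) := by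
        refine (Finset.abs_sum_le_sum_abs _ _).trans (Finset.sum_le_sum fun d hd ↦ ?_)
        rw [← mul_sub, abs_mul]
        gcongr
        have hdq := Nat.dvd_of_mem_divisors hd
        have hd0 : 0 < d := Nat.pos_of_mem_divisors hd
        have hn : q / d ≠ 0 := (Nat.div_pos (Nat.le_of_dvd hq hdq) hd0).ne'
        have hd0' : (d : ℝ) ≠ 0 := by positivity
        have h1 : ∀ j : ℕ, ((d * j : ℕ) : ℝ) / q = j / (q / d : ℕ) := by
          intro j
          rw [Nat.cast_div hdq hd0']
          push_cast
          have : (q : ℝ) ≠ 0 := by positivity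
          field_simp
        simp only [h1]
        refine (hB _ hn).trans ?_
        gcongr
        exact Nat.div_le_self _ _
    _ = B * ((q : ℝ) ^ p * 2 ^ q.primeFactors.card) := by
        rw [← Finset.sum_mul, sum_abs_moebius_divisors hq0]; ring

lemma sum_Icc_one_eq_sum_range (f : ℕ → ℝ) (n : ℕ) :
    ∑ j ∈ Finset.Icc 1 n, f j = ∑ i ∈ Finset.range n, f (i + 1) := by
  induction n with
  | zero => simp
  | succ n ih => rw [Finset.sum_Icc_succ_top (by omega), Finset.sum_range_succ, ih]

lemma abs_riemannSum_sub_le_of_lipschitzWith {H : ℝ → ℝ} {L : NNReal} (hH : LipschitzWith L H)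
    {n : ℕ} (hn : n ≠ 0) :
    |∑ j ∈ Finset.Icc 1 n, H (j / n) - n * ∫ x in (0 : ℝ)..1, H x| ≤ L := by
  have hn0 : (0 : ℝ) < n := by positivity
  have hcont : Continuous fun x : ℝ ↦ H (x / n) := hH.continuous.comp (by fun_prop)
  have h1 : n * ∫ x in (0 : ℝ)..1, H x = ∑ i ∈ Finset.range n,
      ∫ x in ((i : ℕ) : ℝ)..((i + 1 : ℕ) : ℝ), H (x / n) := by
    rw [intervalIntegral.sum_integral_adjacent_intervals
      (fun k _ ↦ hcont.intervalIntegrable _ _), intervalIntegral.integral_comp_div _ hn0.ne']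
    simp [hn0.ne']
  rw [sum_Icc_one_eq_sum_range (fun j ↦ H (j / n)), h1, ← Finset.sum_sub_distrib]
  calc _ ≤ ∑ i ∈ Finset.range n, (L : ℝ) / n := by
        refine (Finset.abs_sum_le_sum_abs _ _).trans (Finset.sum_le_sum fun i _ ↦ ?_)
        have hc : H (((i + 1 : ℕ) : ℝ) / n) =
            ∫ _x in ((i : ℕ) : ℝ)..((i + 1 : ℕ) : ℝ), H (((i + 1 : ℕ) : ℝ) / n) := by
          simp
        rw [hc, ← intervalIntegral.integral_sub (by simp) (hcont.intervalIntegrable _ _)]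
        have := intervalIntegral.norm_integral_le_of_norm_le_const (a := ((i : ℕ) : ℝ))
          (b := ((i + 1 : ℕ) : ℝ)) (C := (L : ℝ) / n)
          (f := fun x ↦ H (((i + 1 : ℕ) : ℝ) / n) - H (x / n)) ?_
        · simpa using this
        · intro x hx
          rw [uIoc_of_le (by push_cast; linarith)] at hx
          have h2 := hH.dist_le_mul (((i + 1 : ℕ) : ℝ) / n) (x / n)
          rw [Real.dist_eq, Real.dist_eq, ← sub_div, abs_div, abs_of_pos hn0] at h2
          rw [Real.norm_eq_abs]
          refine h2.trans ?_
          rw [← mul_div_assoc]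
          gcongr
          have : |((i + 1 : ℕ) : ℝ) - x| ≤ 1 := by
            rw [abs_le]; push_cast at hx ⊢; constructor <;> linarith [hx.1, hx.2]
          nlinarith [L.coe_nonneg]
    _ = L := by simp; field_simp

lemma abs_riemannSum_rpow_neg_sub_le {p : ℝ} (hp0 : 0 < p) (hp : p < 1) {n : ℕ} (hn : n ≠ 0) :
    |∑ j ∈ Finset.Icc 1 n, ((j : ℝ) / n) ^ (-p) - n * (1 - p)⁻¹| ≤
      (1 + (1 - p)⁻¹) * (n : ℝ) ^ p := by
  have hn0 : (0 : ℝ) < n := by positivity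
  have hp1 : 0 < 1 - p := by linarith
  have hanti : ∀ m : ℕ, AntitoneOn (fun x : ℝ ↦ x ^ (-p)) (Icc 1 (1 + m)) := by
    intro m x hx y hy hxy
    exact Real.rpow_le_rpow_of_nonpos (by linarith [hx.1]) hxy (by linarith)
  have hint : ∀ m : ℕ, ∫ x in (1 : ℝ)..(1 + m), x ^ (-p) =
      ((1 + m : ℝ) ^ (1 - p) - 1) * (1 - p)⁻¹ := by
    intro m
    rw [integral_rpow (Or.inl (by linarith))]
    rw [Real.one_rpow, neg_add_eq_sub, div_eq_mul_inv]
  have hlow := (hanti n).integral_le_sum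
  have hup : ∑ i ∈ Finset.range n, ((i : ℝ) + 1) ^ (-p) ≤
      1 + ((n : ℝ) ^ (1 - p) - 1) * (1 - p)⁻¹ := by
    obtain ⟨m, rfl⟩ := Nat.exists_eq_succ_of_ne_zero hn
    have h := (hanti m).sum_le_integral
    rw [hint] at h
    rw [Finset.sum_range_succ']
    push_cast at h ⊢
    simp only [zero_add, Real.one_rpow]
    simp only [add_comm (1 : ℝ)] at h
    linarith
  rw [hint] at hlow
  have hmono : (n : ℝ) ^ (1 - p) ≤ (1 + n : ℝ) ^ (1 - p) :=
    Real.rpow_le_rpow hn0.le (by linarith) hp1.le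
  have hinv : 0 < (1 - p)⁻¹ := by positivity
  have hsum : ∑ j ∈ Finset.Icc 1 n, ((j : ℝ) / n) ^ (-p) =
      (n : ℝ) ^ p * ∑ i ∈ Finset.range n, ((i : ℝ) + 1) ^ (-p) := by
    rw [sum_Icc_one_eq_sum_range (fun j ↦ ((j : ℝ) / n) ^ (-p)), Finset.mul_sum]
    refine Finset.sum_congr rfl fun i _ ↦ ?_
    rw [Real.div_rpow (by positivity) hn0.le, Real.rpow_neg hn0.le, div_inv_eq_mul, mul_comm]
    push_cast; rfl
  have hnn : (n : ℝ) * (1 - p)⁻¹ = (n : ℝ) ^ p * ((n : ℝ) ^ (1 - p) * (1 - p)⁻¹) := by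
    rw [← mul_assoc, ← Real.rpow_add hn0]; simp
  rw [hsum, hnn, ← mul_sub, abs_mul, abs_of_nonneg (by positivity), mul_comm]
  gcongr
  rw [abs_le]
  simp only [add_comm (1 : ℝ)] at hlow hmono
  constructor
  · nlinarith
  · nlinarith

/-- The quantity `1 / |sin (π t)|`, with value `0` at integers. -/
noncomputable def cosecAbs (t : ℝ) : ℝ := |Real.sin (Real.pi * t)|⁻¹

lemma cosecAbs_nonneg (t : ℝ) : 0 ≤ cosecAbs t := by unfold cosecAbs; positivity

lemma cosecAbs_add_int (t : ℝ) (m : ℤ) : cosecAbs (t + m) = cosecAbs t := by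
  unfold cosecAbs
  rw [mul_add, mul_comm Real.pi (m : ℝ), Real.sin_add_int_mul_pi, abs_mul]
  simp

lemma cosecAbs_add_nat (t : ℝ) (m : ℕ) : cosecAbs (t + m) = cosecAbs t := by
  exact_mod_cast cosecAbs_add_int t m

lemma cosecAbs_int (m : ℤ) : cosecAbs m = 0 := by
  have := cosecAbs_add_int 0 m
  rw [zero_add] at this
  rw [this]; simp [cosecAbs]

lemma measurable_cosecAbs : Measurable cosecAbs := by
  unfold cosecAbs
  exact ((Real.measurable_sin.comp (measurable_const_mul _)).norm).inv

lemma cosecAbs_rpow_le {p : ℝ} (hp : 0 < p) {x : ℝ} (h0 : 0 < x) (h1 : x < 1) :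
    cosecAbs x ^ p ≤ x ^ (-p) + (1 - x) ^ (-p) := by
  have h1' : 0 < 1 - x := by linarith
  have key : ∀ y : ℝ, 0 < y → y ≤ 1 / 2 → cosecAbs y ^ p ≤ y ^ (-p) := by
    intro y hy hy2
    have h := Real.mul_le_sin (x := Real.pi * y) (by positivity) (by nlinarith [Real.pi_pos])
    have h2 : y ≤ Real.sin (Real.pi * y) := by
      have : 2 / Real.pi * (Real.pi * y) = 2 * y := by field_simp
      linarith
    rw [Real.rpow_neg hy.le, ← Real.inv_rpow hy.le]
    refine Real.rpow_le_rpow (cosecAbs_nonneg _) ?_ hp.le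
    unfold cosecAbs
    rw [abs_of_nonneg (by linarith)]
    exact inv_anti₀ hy h2
  rcases le_total x (1 / 2) with h | h
  · have := key x h0 h
    have : 0 ≤ (1 - x) ^ (-p) := by positivity
    linarith
  · have := key (1 - x) h1' (by linarith)
    have hs : cosecAbs (1 - x) = cosecAbs x := by
      unfold cosecAbs
      rw [mul_sub, mul_one, Real.sin_pi_sub]
    rw [hs] at this
    have : 0 ≤ x ^ (-p) := by positivity
    linarith

lemma sum_coprime_reflect_le (f : ℝ → ℝ) (hf : f 0 ≤ f 1) {q : ℕ} (hq : q ≠ 0) :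
    ∑ b ∈ (Finset.Icc 1 q).filter (fun b ↦ Nat.Coprime b q), f (1 - b / q) ≤
      ∑ b ∈ (Finset.Icc 1 q).filter (fun b ↦ Nat.Coprime b q), f (b / q) := by
  have hq0 : (q : ℝ) ≠ 0 := by positivity
  rcases Nat.lt_or_ge q 2 with h | h
  · obtain rfl : q = 1 := by omega
    simp [hf]
  have hlt : ∀ b ∈ (Finset.Icc 1 q).filter (fun b ↦ Nat.Coprime b q), b < q := by
    intro b hb
    simp only [Finset.mem_filter, Finset.mem_Icc] at hb
    refine lt_of_le_of_ne hb.1.2 ?_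
    rintro rfl
    simp at hb; omega
  have hmem : ∀ b ∈ (Finset.Icc 1 q).filter (fun b ↦ Nat.Coprime b q),
      q - b ∈ (Finset.Icc 1 q).filter (fun b ↦ Nat.Coprime b q) := by
    intro b hb
    have := hlt b hb
    simp only [Finset.mem_filter, Finset.mem_Icc] at hb ⊢
    exact ⟨⟨by omega, by omega⟩, (Nat.coprime_self_sub_left hb.1.2).mpr hb.2⟩
  refine (Finset.sum_nbij' (fun b ↦ q - b) (fun b ↦ q - b) hmem hmem ?_ ?_ ?_).le
  · intro b hb; have := hlt b hb; omega
  · intro b hb; have := hlt b hb; omega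
  · intro b hb
    have := hlt b hb
    rw [Nat.cast_sub this.le, sub_div, div_self hq0]

lemma exists_sum_coprime_cosecAbs_le {p : ℝ} (hp0 : 0 < p) (hp : p < 1) :
    ∃ C : ℝ, 0 ≤ C ∧ ∀ q : ℕ, q ≠ 0 →
      ∑ b ∈ (Finset.Icc 1 q).filter (fun b ↦ Nat.Coprime b q), cosecAbs (b / q) ^ p ≤
        C * q.totient := by
  have hbdd := (tendsto_sum_coprime_div_totient (g := fun x ↦ x ^ (-p)) hp0.le hp
    (fun n hn ↦ abs_riemannSum_rpow_neg_sub_le hp0 hp hn)).bddAbove_range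
  obtain ⟨C, hC⟩ := hbdd
  refine ⟨2 * max C 0, by positivity, fun q hq ↦ ?_⟩
  have hφ : (0 : ℝ) < q.totient := by exact_mod_cast Nat.totient_pos.mpr (Nat.pos_of_ne_zero hq)
  have h1 := hC ⟨q, rfl⟩
  simp only [div_le_iff₀ hφ] at h1
  have hle : ∀ b ∈ (Finset.Icc 1 q).filter (fun b ↦ Nat.Coprime b q), cosecAbs (b / q) ^ p ≤
      ((b : ℝ) / q) ^ (-p) + ((1 : ℝ) - b / q) ^ (-p) := by
    intro b hb
    simp only [Finset.mem_filter, Finset.mem_Icc] at hb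
    have hq0 : (0 : ℝ) < q := by positivity
    have hb0 : (0 : ℝ) < b := by exact_mod_cast hb.1.1
    rcases hb.1.2.lt_or_eq with h | h
    · exact cosecAbs_rpow_le hp0 (by positivity)
        ((div_lt_one hq0).mpr (by exact_mod_cast h))
    · rw [h, div_self hq0.ne']
      have : cosecAbs 1 = 0 := by exact_mod_cast cosecAbs_int 1
      rw [this, Real.zero_rpow hp0.ne']
      positivity
  have hrefl := sum_coprime_reflect_le (fun x ↦ x ^ (-p))
    (by rw [Real.zero_rpow (by linarith), Real.one_rpow]; norm_num) hq
  calc _ ≤ _ := Finset.sum_le_sum hle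
    _ ≤ C * q.totient + C * q.totient := by
        rw [Finset.sum_add_distrib]
        exact add_le_add h1 (hrefl.trans h1)
    _ ≤ 2 * max C 0 * q.totient := by nlinarith [le_max_left C 0]

lemma sum_coprime_eq_sum_units {q : ℕ} [NeZero q] (f : ZMod q → ℝ) :
    ∑ b ∈ (Finset.Icc 1 q).filter (fun b ↦ Nat.Coprime b q), f b = ∑ u : (ZMod q)ˣ, f u := by
  refine Finset.sum_bij (fun b hb ↦ ZMod.unitOfCoprime b (Finset.mem_filter.mp hb).2)
    (fun _ _ ↦ Finset.mem_univ _) ?_ ?_ (fun _ _ ↦ by simp)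
  · intro b hb c hc h
    simp only [Finset.mem_filter, Finset.mem_Icc] at hb hc
    have h' : (b : ZMod q) = c := by simpa using congrArg Units.val h
    rw [ZMod.natCast_eq_natCast_iff] at h'
    have h1 : b - 1 ≡ c - 1 [MOD q] := by
      refine Nat.ModEq.add_right_cancel' 1 ?_
      rwa [Nat.sub_add_cancel hb.1.1, Nat.sub_add_cancel hc.1.1]
    have := Nat.ModEq.eq_of_lt_of_lt h1 (by omega) (by omega)
    omega
  · intro u _
    rcases Nat.eq_zero_or_pos (u : ZMod q).val with h | h
    · have hu := ZMod.val_coe_unit_coprime u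
      rw [h, Nat.coprime_zero_left] at hu
      refine ⟨1, by simp [hu], ?_⟩
      subst hu
      exact Subsingleton.elim _ _
    · refine ⟨(u : ZMod q).val, ?_, ?_⟩
      · simp only [Finset.mem_filter, Finset.mem_Icc]
        exact ⟨⟨h, (ZMod.val_lt _).le⟩, ZMod.val_coe_unit_coprime u⟩
      · ext; simp

lemma card_mul_sum_comp_eq {G H : Type*} [Group G] [Group H] [Fintype G] [Fintype H]
    (φ : G →* H) (hφ : Function.Surjective φ) (f : H → ℝ) :
    (Fintype.card H : ℝ) * ∑ g, f (φ g) = Fintype.card G * ∑ h, f h := by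
  classical
  have hfib : ∀ h : H, (Finset.univ.filter fun g ↦ φ g = h).card =
      (Finset.univ.filter fun g ↦ φ g = 1).card := fun h ↦
    MonoidHom.card_fiber_eq_of_mem_range φ (hφ h) (hφ 1)
  have hsum : ∀ F : H → ℝ, ∑ g, F (φ g) =
      (Finset.univ.filter fun g ↦ φ g = 1).card * ∑ h, F h := by
    intro F
    rw [← Finset.sum_fiberwise Finset.univ φ, Finset.mul_sum]
    refine Finset.sum_congr rfl fun h _ ↦ ?_
    rw [Finset.sum_congr rfl fun g hg ↦ by rw [(Finset.mem_filter.mp hg).2],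
      Finset.sum_const, hfib, nsmul_eq_mul]
  have h1 := hsum fun _ ↦ 1
  simp only [Finset.sum_const, Finset.card_univ, nsmul_eq_mul, mul_one] at h1
  rw [hsum, h1]; ring

lemma exists_sum_coprime_cosecAbs_mul_le {p : ℝ} (hp0 : 0 < p) (hp : p < 1) :
    ∃ C : ℝ, 0 ≤ C ∧ ∀ q : ℕ, q ≠ 0 → ∀ k : ℕ,
      ∑ b ∈ (Finset.Icc 1 q).filter (fun b ↦ Nat.Coprime b q), cosecAbs (k * (b / q)) ^ p ≤
        C * q.totient := by
  obtain ⟨C, hC0, hC⟩ := exists_sum_coprime_cosecAbs_le hp0 hp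
  refine ⟨C, hC0, fun q hq k ↦ ?_⟩
  set d := Nat.gcd k q
  have hd : 0 < d := Nat.gcd_pos_of_pos_right _ (Nat.pos_of_ne_zero hq)
  obtain ⟨k', hk⟩ : d ∣ k := Nat.gcd_dvd_left _ _
  obtain ⟨n, hn⟩ : d ∣ q := Nat.gcd_dvd_right _ _
  have hcop : Nat.Coprime k' n := by
    have := Nat.coprime_div_gcd_div_gcd (m := k) (n := q) hd
    rwa [show k / Nat.gcd k q = k' from Nat.div_eq_of_eq_mul_right hd hk,
      show q / Nat.gcd k q = n from Nat.div_eq_of_eq_mul_right hd hn] at this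
  have hn0 : n ≠ 0 := by rintro rfl; simp at hn; exact hq hn
  have : NeZero n := ⟨hn0⟩
  have : NeZero q := ⟨hq⟩
  let Φ : ZMod n → ℝ := fun v ↦ cosecAbs (v.val / n) ^ p
  have hΦ : ∀ m : ℕ, cosecAbs (m / n) ^ p = Φ m := by
    intro m
    simp only [Φ, ZMod.val_natCast]
    conv_lhs => rw [← Nat.mod_add_div m n]
    have : ((m % n + n * (m / n) : ℕ) : ℝ) / n = ((m % n : ℕ) : ℝ) / n + (m / n : ℕ) := by
      push_cast; field_simp
    rw [this, cosecAbs_add_nat]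
  have hnq : n ∣ q := Dvd.intro_left d hn.symm
  have hcast : ∀ b : ℕ, cosecAbs (k * (b / q)) ^ p =
      Φ (k' * ZMod.castHom hnq (ZMod n) (b : ZMod q)) := by
    intro b
    have h1 : (k : ℝ) * (b / q) = ((k' * b : ℕ) : ℝ) / n := by
      have hd' : (d : ℝ) ≠ 0 := by positivity
      have hn' : (n : ℝ) ≠ 0 := by positivity
      have hk2 : (k : ℝ) = d * k' := by exact_mod_cast hk
      have hq2 : (q : ℝ) = d * n := by exact_mod_cast hn
      rw [hk2, hq2]; push_cast; field_simp
    rw [h1, hΦ]; simp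
  have hφn : (0 : ℝ) < n.totient := by
    exact_mod_cast Nat.totient_pos.mpr (Nat.pos_of_ne_zero hn0)
  rw [Finset.sum_congr rfl fun b _ ↦ hcast b,
    sum_coprime_eq_sum_units (fun v ↦ Φ (k' * ZMod.castHom hnq (ZMod n) v))]
  have hbase := hC n hn0
  rw [Finset.sum_congr rfl fun b _ ↦ hΦ b, sum_coprime_eq_sum_units Φ,
    ← Equiv.sum_comp (Equiv.mulLeft (ZMod.unitOfCoprime k' hcop)) (fun u ↦ Φ (u : ZMod n))] at hbase
  have hgrp := card_mul_sum_comp_eq (ZMod.unitsMap hnq) (ZMod.unitsMap_surjective hnq)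
    (fun u ↦ Φ (k' * (u : ZMod n)))
  simp only [Equiv.coe_mulLeft, Units.val_mul, ZMod.coe_unitOfCoprime] at hbase
  rw [ZMod.card_units_eq_totient, ZMod.card_units_eq_totient] at hgrp
  have hunits : ∀ u : (ZMod q)ˣ, ((ZMod.unitsMap hnq u : (ZMod n)ˣ) : ZMod n) =
      ZMod.castHom hnq (ZMod n) u := fun _ ↦ rfl
  simp only [hunits] at hgrp
  refine le_of_mul_le_mul_left ?_ hφn
  rw [hgrp]
  calc _ ≤ (q.totient : ℝ) * (C * n.totient) := by gcongr
    _ = _ := by ring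

lemma periodic_cosecAbs_rpow (p : ℝ) : Function.Periodic (fun x ↦ cosecAbs x ^ p) 1 := by
  intro x
  have := cosecAbs_add_nat x 1
  simp only [Nat.cast_one] at this
  simp only [this]

lemma intervalIntegrable_zero_one_cosecAbs_rpow {p : ℝ} (hp0 : 0 < p) (hp : p < 1) :
    IntervalIntegrable (fun x ↦ cosecAbs x ^ p) volume 0 1 := by
  have h1 : IntervalIntegrable (fun x : ℝ ↦ x ^ (-p)) volume 0 1 :=
    intervalIntegral.intervalIntegrable_rpow' (by linarith)
  have h2 : IntervalIntegrable (fun x : ℝ ↦ (1 - x) ^ (-p)) volume 0 1 := by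
    simpa using (h1.comp_sub_left 1).symm
  refine (h1.add h2).mono_fun' ((measurable_cosecAbs.pow_const p).aestronglyMeasurable) ?_
  rw [uIoc_of_le zero_le_one, ← Measure.restrict_congr_set Ioo_ae_eq_Ioc]
  filter_upwards [ae_restrict_mem measurableSet_Ioo] with x hx
  rw [Real.norm_eq_abs, abs_of_nonneg (Real.rpow_nonneg (cosecAbs_nonneg x) p)]
  exact cosecAbs_rpow_le hp0 hx.1 hx.2

lemma intervalIntegrable_cosecAbs_rpow_of_lt_one {p : ℝ} (hp0 : 0 < p) (hp : p < 1) (a b : ℝ) :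
    IntervalIntegrable (fun x ↦ cosecAbs x ^ p) volume a b :=
  (periodic_cosecAbs_rpow p).intervalIntegrable one_ne_zero (t := 0)
    (by simpa using intervalIntegrable_zero_one_cosecAbs_rpow hp0 hp) a b

lemma integrableOn_cosecAbs_mul_rpow {p : ℝ} (hp0 : 0 < p) (hp : p < 1) (k : ℕ) :
    IntegrableOn (fun x ↦ cosecAbs (k * x) ^ p) (Icc 0 1) := by
  rw [integrableOn_Icc_iff_integrableOn_Ioc, ← intervalIntegrable_iff_integrableOn_Ioc_of_le
    zero_le_one]
  rcases eq_or_ne k 0 with rfl | hk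
  · simp
  · have := (intervalIntegrable_cosecAbs_rpow_of_lt_one hp0 hp 0 k).comp_mul_left (c := k)
    simpa [hk] using this

lemma setIntegral_cosecAbs_mul_rpow {p : ℝ} (hp0 : 0 < p) (hp : p < 1) {k : ℕ} (hk : k ≠ 0) :
    ∫ x in Icc (0 : ℝ) 1, cosecAbs (k * x) ^ p = ∫ x in Icc (0 : ℝ) 1, cosecAbs x ^ p := by
  have hk0 : (k : ℝ) ≠ 0 := by positivity
  rw [integral_Icc_eq_integral_Ioc, integral_Icc_eq_integral_Ioc,
    ← intervalIntegral.integral_of_le zero_le_one, ← intervalIntegral.integral_of_le zero_le_one]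
  have h := (periodic_cosecAbs_rpow p).intervalIntegral_add_zsmul_eq (k : ℤ) 0
    (intervalIntegrable_cosecAbs_rpow_of_lt_one hp0 hp)
  rw [intervalIntegral.integral_comp_mul_left (fun x ↦ cosecAbs x ^ p) hk0]
  simp only [zsmul_eq_mul, Int.cast_natCast, mul_one, zero_add] at h
  simp [h, hk0]

lemma norm_sum_rpow_le {ι E : Type*} [SeminormedAddCommGroup E] {p : ℝ} (hp0 : 0 < p) (hp : p ≤ 1)
    (f : ι → E) (s : Finset ι) : ‖∑ i ∈ s, f i‖ ^ p ≤ ∑ i ∈ s, ‖f i‖ ^ p := by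
  classical
  induction s using Finset.induction_on with
  | empty => simp [hp0.ne']
  | insert i s hi ih =>
    rw [Finset.sum_insert hi, Finset.sum_insert hi]
    calc _ ≤ (‖f i‖ + ‖∑ i ∈ s, f i‖) ^ p := by gcongr; exact norm_add_le _ _
      _ ≤ ‖f i‖ ^ p + ‖∑ i ∈ s, f i‖ ^ p :=
        Real.rpow_add_le_add_rpow (norm_nonneg _) (norm_nonneg _) hp0.le hp
      _ ≤ _ := by gcongr

lemma summable_norm_of_summable_norm_rpow {E : Type*} [SeminormedAddCommGroup E] {p : ℝ}
    (hp0 : 0 < p) (hp : p ≤ 1) {f : ℕ → E} (hf : Summable fun k ↦ ‖f k‖ ^ p) :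
    Summable fun k ↦ ‖f k‖ := by
  refine Summable.of_norm_bounded_eventually_nat hf ?_
  filter_upwards [hf.tendsto_atTop_zero.eventually_le_const zero_lt_one] with k hk
  rw [norm_norm]
  have h1 : ‖f k‖ ≤ 1 := by
    by_contra! h
    exact absurd hk (not_le.mpr (Real.one_lt_rpow h hp0))
  simpa using Real.rpow_le_rpow_of_exponent_ge' (norm_nonneg (f k)) h1 hp0.le hp

lemma norm_tsum_rpow_le {E : Type*} [NormedAddCommGroup E] [CompleteSpace E] {p : ℝ}
    (hp0 : 0 < p) (hp : p ≤ 1) {f : ℕ → E} (hf : Summable fun k ↦ ‖f k‖ ^ p) :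
    ‖∑' k, f k‖ ^ p ≤ ∑' k, ‖f k‖ ^ p := by
  have h := (summable_norm_of_summable_norm_rpow hp0 hp hf).of_norm.hasSum.tendsto_sum_nat
  refine le_of_tendsto_of_tendsto' (h.norm.rpow_const (Or.inr hp0.le))
    hf.hasSum.tendsto_sum_nat fun n ↦ norm_sum_rpow_le hp0 hp f _

/-- The series `∑ w k cot (π k x)`. -/
noncomputable def cotSeries (w : ℕ → ℂ) (x : ℝ) : ℂ :=
  ∑' k : ℕ, w k * ((Real.cot (Real.pi * (k * x)) : ℝ) : ℂ)

/-- The series `∑ |w k|^p |sin (π k x)|^(-p)` dominating `‖cotSeries w x‖ ^ p`. -/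
noncomputable def cosecSeries (p : ℝ) (w : ℕ → ℂ) (x : ℝ) : ℝ :=
  ∑' k : ℕ, ‖w k‖ ^ p * cosecAbs (k * x) ^ p

lemma abs_cot_le_cosecAbs (t : ℝ) : |Real.cot (Real.pi * t)| ≤ cosecAbs t := by
  rw [Real.cot_eq_cos_div_sin, abs_div, cosecAbs, div_eq_mul_inv]
  exact mul_le_of_le_one_left (by positivity) (Real.abs_cos_le_one _)

lemma norm_mul_cot_rpow_le {p : ℝ} (hp0 : 0 < p) (z : ℂ) (t : ℝ) :
    ‖z * ((Real.cot (Real.pi * t) : ℝ) : ℂ)‖ ^ p ≤ ‖z‖ ^ p * cosecAbs t ^ p := by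
  rw [← Real.mul_rpow (norm_nonneg _) (cosecAbs_nonneg _), norm_mul, Complex.norm_real,
    Real.norm_eq_abs]
  gcongr
  exact abs_cot_le_cosecAbs t

lemma summable_norm_mul_cot {p : ℝ} (hp0 : 0 < p) (hp : p ≤ 1) {w : ℕ → ℂ} {x : ℝ}
    (h : Summable fun k : ℕ ↦ ‖w k‖ ^ p * cosecAbs (k * x) ^ p) :
    Summable fun k : ℕ ↦ ‖w k * ((Real.cot (Real.pi * (k * x)) : ℝ) : ℂ)‖ :=
  summable_norm_of_summable_norm_rpow hp0 hp
    (h.of_nonneg_of_le (fun _ ↦ by positivity) fun _ ↦ norm_mul_cot_rpow_le hp0 _ _)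

lemma norm_cotSeries_rpow_le {p : ℝ} (hp0 : 0 < p) (hp : p ≤ 1) {w : ℕ → ℂ} {x : ℝ}
    (h : Summable fun k : ℕ ↦ ‖w k‖ ^ p * cosecAbs (k * x) ^ p) :
    ‖cotSeries w x‖ ^ p ≤ cosecSeries p w x := by
  have h' := h.of_nonneg_of_le (fun _ ↦ by positivity)
    fun k ↦ norm_mul_cot_rpow_le hp0 (w k) (k * x)
  exact (norm_tsum_rpow_le hp0 hp h').trans
    (h'.tsum_le_tsum (fun k ↦ norm_mul_cot_rpow_le hp0 _ _) h)

lemma ae_summable_and_integrable_tsum {α : Type*} [MeasurableSpace α] {μ : Measure α}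
    {f : ℕ → α → ℝ} (hf0 : ∀ k x, 0 ≤ f k x) (hf : ∀ k, Integrable (f k) μ)
    (hs : Summable fun k ↦ ∫ x, f k x ∂μ) :
    (∀ᵐ x ∂μ, Summable fun k ↦ f k x) ∧ Integrable (fun x ↦ ∑' k, f k x) μ := by
  have hm : ∀ k, AEMeasurable (fun x ↦ ENNReal.ofReal (f k x)) μ :=
    fun k ↦ (hf k).aemeasurable.ennreal_ofReal
  have hfin : ∫⁻ x, ∑' k, ENNReal.ofReal (f k x) ∂μ ≠ ⊤ := by
    rw [lintegral_tsum hm]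
    simp_rw [← ofReal_integral_eq_lintegral_ofReal (hf _) (ae_of_all _ (hf0 _))]
    exact hs.tsum_ofReal_ne_top
  have hmt : AEMeasurable (fun x ↦ ∑' k, ENNReal.ofReal (f k x)) μ := .tsum hm
  constructor
  · filter_upwards [ae_lt_top' hmt hfin] with x hx
    have := ENNReal.summable_toReal hx.ne
    simpa only [ENNReal.toReal_ofReal (hf0 _ x)] using this
  · convert integrable_toReal_of_lintegral_ne_top hmt hfin using 2 with x
    rw [ENNReal.tsum_toReal_eq fun _ ↦ ENNReal.ofReal_ne_top]
    simp only [ENNReal.toReal_ofReal (hf0 _ x)]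

lemma setIntegral_cosecAbs_mul_rpow_le {p : ℝ} (hp0 : 0 < p) (hp : p < 1) (k : ℕ) :
    ∫ x in Icc (0 : ℝ) 1, cosecAbs (k * x) ^ p ≤ ∫ x in Icc (0 : ℝ) 1, cosecAbs x ^ p := by
  rcases eq_or_ne k 0 with rfl | hk
  · have h0 : cosecAbs 0 = 0 := by simpa using cosecAbs_int 0
    simp only [Nat.cast_zero, zero_mul, h0, Real.zero_rpow hp0.ne', integral_zero]
    exact integral_nonneg fun x ↦ Real.rpow_nonneg (cosecAbs_nonneg x) p
  · exact (setIntegral_cosecAbs_mul_rpow hp0 hp hk).le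

section

variable {p : ℝ} {w : ℕ → ℂ}

lemma summable_setIntegral_cosecAbs (hp0 : 0 < p) (hp : p < 1) (hw : Summable fun k ↦ ‖w k‖ ^ p) :
    Summable fun k : ℕ ↦ ∫ x in Icc (0 : ℝ) 1, ‖w k‖ ^ p * cosecAbs (k * x) ^ p := by
  refine (hw.mul_right (∫ x in Icc (0 : ℝ) 1, cosecAbs x ^ p)).of_nonneg_of_le
    (fun k ↦ integral_nonneg fun x ↦ mul_nonneg (by positivity)
      (Real.rpow_nonneg (cosecAbs_nonneg _) p)) fun k ↦ ?_
  rw [integral_const_mul]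
  exact mul_le_mul_of_nonneg_left (setIntegral_cosecAbs_mul_rpow_le hp0 hp k) (by positivity)

lemma ae_summable_cosecAbs (hp0 : 0 < p) (hp : p < 1) (hw : Summable fun k ↦ ‖w k‖ ^ p) :
    ∀ᵐ x ∂volume.restrict (Icc (0 : ℝ) 1),
      Summable fun k : ℕ ↦ ‖w k‖ ^ p * cosecAbs (k * x) ^ p :=
  (ae_summable_and_integrable_tsum (f := fun (k : ℕ) x ↦ ‖w k‖ ^ p * cosecAbs (k * x) ^ p)
    (fun k x ↦ mul_nonneg (by positivity) (Real.rpow_nonneg (cosecAbs_nonneg _) p))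
    (fun k ↦ (integrableOn_cosecAbs_mul_rpow hp0 hp k).const_mul _)
    (summable_setIntegral_cosecAbs hp0 hp hw)).1

lemma integrableOn_cosecSeries (hp0 : 0 < p) (hp : p < 1) (hw : Summable fun k ↦ ‖w k‖ ^ p) :
    IntegrableOn (cosecSeries p w) (Icc 0 1) :=
  (ae_summable_and_integrable_tsum (f := fun (k : ℕ) x ↦ ‖w k‖ ^ p * cosecAbs (k * x) ^ p)
    (fun k x ↦ mul_nonneg (by positivity) (Real.rpow_nonneg (cosecAbs_nonneg _) p))
    (fun k ↦ (integrableOn_cosecAbs_mul_rpow hp0 hp k).const_mul _)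
    (summable_setIntegral_cosecAbs hp0 hp hw)).2

lemma setIntegral_cosecSeries_le (hp0 : 0 < p) (hp : p < 1) (hw : Summable fun k ↦ ‖w k‖ ^ p) :
    ∫ x in Icc (0 : ℝ) 1, cosecSeries p w x ≤
      (∫ x in Icc (0 : ℝ) 1, cosecAbs x ^ p) * ∑' k, ‖w k‖ ^ p := by
  have hnn : ∀ (k : ℕ) (x : ℝ), 0 ≤ ‖w k‖ ^ p * cosecAbs (k * x) ^ p := fun k x ↦
    mul_nonneg (by positivity) (Real.rpow_nonneg (cosecAbs_nonneg _) p)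
  have hsum := summable_setIntegral_cosecAbs hp0 hp hw
  have := hasSum_integral_of_summable_integral_norm (μ := volume.restrict (Icc (0 : ℝ) 1))
    (F := fun (k : ℕ) x ↦ ‖w k‖ ^ p * cosecAbs (k * x) ^ p)
    (fun k ↦ (integrableOn_cosecAbs_mul_rpow hp0 hp k).const_mul _)
    (by simpa only [Real.norm_of_nonneg (hnn _ _)] using hsum)
  rw [show ∫ x in Icc (0 : ℝ) 1, cosecSeries p w x = _ from this.tsum_eq.symm, ← tsum_mul_left]
  refine hsum.tsum_le_tsum (fun k ↦ ?_) (hw.mul_left _)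
  rw [integral_const_mul, mul_comm]
  exact mul_le_mul_of_nonneg_right (setIntegral_cosecAbs_mul_rpow_le hp0 hp k) (by positivity)

lemma exists_sum_coprime_cosecSeries_le (hp0 : 0 < p) (hp : p < 1) :
    ∃ C, 0 ≤ C ∧ ∀ w : ℕ → ℂ, (Summable fun k ↦ ‖w k‖ ^ p) → ∀ q ≠ 0,
      (∀ b ∈ (Finset.Icc 1 q).filter (fun b ↦ Nat.Coprime b q),
        Summable fun k : ℕ ↦ ‖w k‖ ^ p * cosecAbs (k * (b / q)) ^ p) ∧
      ∑ b ∈ (Finset.Icc 1 q).filter (fun b ↦ Nat.Coprime b q), cosecSeries p w (b / q) ≤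
        (C * ∑' k, ‖w k‖ ^ p) * q.totient := by
  obtain ⟨C, hC0, hC⟩ := exists_sum_coprime_cosecAbs_mul_le hp0 hp
  refine ⟨C, hC0, fun w hw q hq ↦ ?_⟩
  have hnn : ∀ t, 0 ≤ cosecAbs t ^ p := fun t ↦ Real.rpow_nonneg (cosecAbs_nonneg _) p
  have hs : ∀ b ∈ (Finset.Icc 1 q).filter (fun b ↦ Nat.Coprime b q),
      Summable fun k : ℕ ↦ ‖w k‖ ^ p * cosecAbs (k * (b / q)) ^ p := by
    intro b hb
    refine (hw.mul_right (C * q.totient)).of_nonneg_of_le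
      (fun k ↦ mul_nonneg (by positivity) (hnn _)) fun k ↦ ?_
    gcongr
    refine le_trans ?_ (hC q hq k)
    exact Finset.single_le_sum (f := fun b : ℕ ↦ cosecAbs (k * (b / q)) ^ p)
      (fun _ _ ↦ hnn _) hb
  refine ⟨hs, ?_⟩
  unfold cosecSeries
  rw [← Summable.tsum_finsetSum hs, mul_right_comm, ← tsum_mul_left]
  refine (summable_sum hs).tsum_le_tsum (fun k ↦ ?_) (hw.mul_left _)
  rw [← Finset.mul_sum, mul_comm]
  gcongr
  exact hC q hq k

lemma aemeasurable_cotSeries (hp0 : 0 < p) (hp : p < 1) (hw : Summable fun k ↦ ‖w k‖ ^ p) :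
    AEMeasurable (cotSeries w) (volume.restrict (Icc (0 : ℝ) 1)) := by
  refine aemeasurable_of_tendsto_metrizable_ae atTop (f := fun n x ↦
    ∑ k ∈ Finset.range n, w k * ((Real.cot (Real.pi * (k * x)) : ℝ) : ℂ)) (fun n ↦ ?_) ?_
  · refine Measurable.aemeasurable (Finset.measurable_sum _ fun k _ ↦ ?_)
    simp only [Real.cot_eq_cos_div_sin]
    fun_prop
  · filter_upwards [ae_summable_cosecAbs hp0 hp hw] with x hx
    exact (summable_norm_mul_cot hp0 hp.le hx).of_norm.hasSum.tendsto_sum_nat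

/-- The sequence `w` with its first `K` terms replaced by zero. -/
def tailWeight (w : ℕ → ℂ) (K k : ℕ) : ℂ := if k < K then 0 else w k

lemma norm_tailWeight_rpow_le (hp0 : 0 < p) (w : ℕ → ℂ) (K k : ℕ) :
    ‖tailWeight w K k‖ ^ p ≤ ‖w k‖ ^ p := by
  unfold tailWeight
  split_ifs
  · rw [norm_zero, Real.zero_rpow hp0.ne']
    positivity
  · rfl

lemma summable_norm_tailWeight_rpow (hp0 : 0 < p) (hw : Summable fun k ↦ ‖w k‖ ^ p) (K : ℕ) :
    Summable fun k ↦ ‖tailWeight w K k‖ ^ p :=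
  hw.of_nonneg_of_le (fun _ ↦ by positivity) fun _ ↦ norm_tailWeight_rpow_le hp0 w K _

lemma tendsto_tsum_norm_tailWeight_rpow (hp0 : 0 < p) (hw : Summable fun k ↦ ‖w k‖ ^ p) :
    Tendsto (fun K ↦ ∑' k, ‖tailWeight w K k‖ ^ p) atTop (𝓝 0) := by
  have := tendsto_tsum_of_dominated_convergence (𝓕 := atTop)
    (f := fun K k ↦ ‖tailWeight w K k‖ ^ p) (g := fun _ ↦ (0 : ℝ)) hw
    (fun k ↦ tendsto_const_nhds.congr' ?_) (Eventually.of_forall fun K k ↦ ?_)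
  · simpa using this
  · filter_upwards [eventually_gt_atTop k] with K hK
    simp [tailWeight, hK, hp0.ne']
  · rw [Real.norm_of_nonneg (by positivity)]
    exact norm_tailWeight_rpow_le hp0 w K k

lemma cotSeries_sub_sum_range (hp0 : 0 < p) (hp : p ≤ 1) {x : ℝ}
    (hx : Summable fun k : ℕ ↦ ‖w k‖ ^ p * cosecAbs (k * x) ^ p) (K : ℕ) :
    cotSeries w x - ∑ k ∈ Finset.range K, w k * ((Real.cot (Real.pi * (k * x)) : ℝ) : ℂ) =
      cotSeries (tailWeight w K) x := by
  have h := (summable_norm_mul_cot hp0 hp hx).of_norm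
  have ht : cotSeries (tailWeight w K) x =
      ∑' k, (w k * ((Real.cot (Real.pi * (k * x)) : ℝ) : ℂ) -
        if k ∈ Finset.range K then w k * ((Real.cot (Real.pi * (k * x)) : ℝ) : ℂ) else 0) := by
    refine tsum_congr fun k ↦ ?_
    by_cases hk : k < K <;> simp [tailWeight, hk]
  rw [ht, Summable.tsum_sub h (summable_of_ne_finset_zero (s := Finset.range K)
    fun k hk ↦ if_neg hk), tsum_eq_sum (f := fun k ↦ if k ∈ Finset.range K then _ else (0 : ℂ))
    (s := Finset.range K) fun k hk ↦ if_neg hk]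
  exact congrArg (cotSeries w x - ·) (Finset.sum_congr rfl fun k hk ↦ (if_pos hk).symm)

lemma summable_tailWeight_cosecAbs (hp0 : 0 < p) {x : ℝ}
    (hx : Summable fun k : ℕ ↦ ‖w k‖ ^ p * cosecAbs (k * x) ^ p) (K : ℕ) :
    Summable fun k : ℕ ↦ ‖tailWeight w K k‖ ^ p * cosecAbs (k * x) ^ p :=
  hx.of_nonneg_of_le
    (fun k ↦ mul_nonneg (by positivity) (Real.rpow_nonneg (cosecAbs_nonneg _) p))
    fun k ↦ mul_le_mul_of_nonneg_right (norm_tailWeight_rpow_le hp0 w K k)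
      (Real.rpow_nonneg (cosecAbs_nonneg _) p)

end

lemma tendsto_average_of_lipschitz {X : Type*} [MeasurableSpace X] [PseudoEMetricSpace X]
    [OpensMeasurableSpace X] {s : ℕ → Finset ℕ} (hs : ∀ᶠ q in atTop, (s q).Nonempty)
    {z : ℕ → ℕ → X} {ν : Measure X} [IsProbabilityMeasure ν]
    (h : ∀ f : X → ℝ, (∃ C, ∀ x y, dist (f x) (f y) ≤ C) → (∃ L, LipschitzWith L f) →
      Tendsto (fun q ↦ (∑ b ∈ s q, f (z q b)) / (s q).card) atTop (𝓝 (∫ x, f x ∂ν)))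
    {f : X → ℝ} (hf : Continuous f) {M : ℝ} (hM : ∀ x, |f x| ≤ M) :
    Tendsto (fun q ↦ (∑ b ∈ s q, f (z q b)) / (s q).card) atTop (𝓝 (∫ x, f x ∂ν)) := by
  classical
  have hprob : ∀ q, (s q).Nonempty → IsProbabilityMeasure
      (((s q).card : ENNReal)⁻¹ • ∑ b ∈ s q, Measure.dirac (z q b)) := by
    intro q hq
    constructor
    simp only [Measure.smul_apply, Measure.finsetSum_apply, measure_univ,
      Finset.sum_const, nsmul_eq_mul, mul_one, smul_eq_mul]
    exact ENNReal.inv_mul_cancel (by simpa using hq.ne_empty) (by simp)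
  obtain ⟨ν', hν'⟩ : ∃ ν' : ProbabilityMeasure X, (ν' : Measure X) = ν := ⟨⟨ν, inferInstance⟩, rfl⟩
  have hex : ∀ q, ∃ μ : ProbabilityMeasure X, (s q).Nonempty →
      (μ : Measure X) = ((s q).card : ENNReal)⁻¹ • ∑ b ∈ s q, Measure.dirac (z q b) := fun q ↦ by
    by_cases hq : (s q).Nonempty
    · exact ⟨⟨_, hprob q hq⟩, fun _ ↦ rfl⟩
    · exact ⟨ν', fun h ↦ absurd h hq⟩
  choose P hP using hex
  have hint : ∀ g : X → ℝ, Continuous g → ∀ q, (s q).Nonempty →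
      ∫ x, g x ∂(P q : Measure X) = (∑ b ∈ s q, g (z q b)) / (s q).card := by
    intro g hg q hq
    have hsm := hg.measurable.stronglyMeasurable
    rw [hP q hq, integral_smul_measure, integral_finsetSum_measure
      fun b _ ↦ integrable_dirac' hsm (by simp)]
    simp only [integral_dirac' _ _ hsm, ENNReal.toReal_inv, ENNReal.toReal_natCast, smul_eq_mul]
    rw [div_eq_inv_mul]
  have hlim : Tendsto P atTop (𝓝 ν') := by
    rw [tendsto_iff_forall_lipschitz_integral_tendsto]
    intro g hg hL
    rw [hν']
    refine (h g hg hL).congr' ?_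
    filter_upwards [hs] with q hq using (hint g hL.choose_spec.continuous q hq).symm
  rw [ProbabilityMeasure.tendsto_iff_forall_integral_tendsto] at hlim
  have hlim' := hlim (BoundedContinuousFunction.ofNormedAddCommGroup f hf M hM)
  rw [hν'] at hlim'
  refine hlim'.congr' ?_
  filter_upwards [hs] with q hq using hint f hf q hq

lemma tendsto_of_forall_approx {u : ℕ → ℝ} {l : ℝ}
    (h : ∀ ε > 0, ∃ v : ℕ → ℝ, ∃ l', Tendsto v atTop (𝓝 l') ∧
      (∀ᶠ q in atTop, |u q - v q| ≤ ε) ∧ |l - l'| ≤ ε) : Tendsto u atTop (𝓝 l) := by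
  rw [Metric.tendsto_atTop']
  intro ε hε
  obtain ⟨v, l', hv, huv, hl⟩ := h (ε / 4) (by positivity)
  obtain ⟨N, hN⟩ :=
    (huv.and (Metric.tendsto_nhds.mp hv (ε / 4) (by positivity))).exists_forall_of_atTop
  refine ⟨N, fun q hq ↦ ?_⟩
  obtain ⟨h1, h2⟩ := hN q hq.le
  rw [Real.dist_eq] at h2 ⊢
  rw [abs_le] at h1 hl
  rw [abs_lt] at h2 ⊢
  constructor <;> linarith

instance : IsProbabilityMeasure (volume.restrict (Icc (0 : ℝ) 1)) := ⟨by simp⟩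

lemma tendsto_average_coprime_continuous {H : ℝ → ℝ} (hH : Continuous H) {M : ℝ}
    (hM : ∀ x, |H x| ≤ M) :
    Tendsto (fun q : ℕ ↦ (∑ b ∈ (Finset.Icc 1 q).filter (fun b ↦ Nat.Coprime b q),
      H (b / q)) / (q.totient : ℝ)) atTop (𝓝 (∫ x in Icc (0 : ℝ) 1, H x)) := by
  have key := tendsto_average_of_lipschitz (X := ℝ)
    (s := fun q ↦ (Finset.Icc 1 q).filter (fun b ↦ Nat.Coprime b q))
    (z := fun q b ↦ (b : ℝ) / q) (ν := volume.restrict (Icc (0 : ℝ) 1)) ?_ ?_ hH hM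
  · simpa only [sum_coprime_one] using key
  · filter_upwards [eventually_ne_atTop 0] with q hq
    rw [← Finset.card_pos, sum_coprime_one]
    exact Nat.totient_pos.mpr (Nat.pos_of_ne_zero hq)
  · rintro f - ⟨L, hL⟩
    simp only [sum_coprime_one]
    refine tendsto_sum_coprime_div_totient (g := f) (B := L) (p := 0) le_rfl zero_lt_one
      fun n hn ↦ ?_
    rw [Real.rpow_zero, mul_one, integral_Icc_eq_integral_Ioc,
      ← intervalIntegral.integral_of_le zero_le_one]
    exact abs_riemannSum_sub_le_of_lipschitzWith hL hn

lemma tendsto_average_coprime_of_ae_continuousAt {H D : ℝ → ℝ} {M : ℝ} (hM : ∀ x, |H x| ≤ M)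
    (hHm : Measurable H) (hD : Continuous D) (hD0 : ∀ x, 0 ≤ D x)
    (hDae : ∀ᵐ x ∂volume.restrict (Icc (0 : ℝ) 1), D x ≠ 0)
    (hH : ∀ x, D x ≠ 0 → ContinuousAt H x) :
    Tendsto (fun q : ℕ ↦ (∑ b ∈ (Finset.Icc 1 q).filter (fun b ↦ Nat.Coprime b q),
      H (b / q)) / (q.totient : ℝ)) atTop (𝓝 (∫ x in Icc (0 : ℝ) 1, H x)) := by
  have hM0 : 0 ≤ M := (abs_nonneg _).trans (hM 0)
  let χ : ℕ → ℝ → ℝ := fun n x ↦ min 1 (n * D x)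
  have hχc : ∀ n, Continuous (χ n) := fun n ↦ by fun_prop
  have hχ0 : ∀ n x, 0 ≤ χ n x := fun n x ↦ le_min zero_le_one (mul_nonneg n.cast_nonneg (hD0 x))
  have hχ1 : ∀ n x, χ n x ≤ 1 := fun n x ↦ min_le_left _ _
  have hχabs : ∀ n x, |χ n x| ≤ 1 := fun n x ↦ by rw [abs_of_nonneg (hχ0 n x)]; exact hχ1 n x
  have hprodM : ∀ n x, |H x * χ n x| ≤ M := fun n x ↦ by
    rw [abs_mul]
    exact (mul_le_mul (hM x) (hχabs n x) (abs_nonneg _) hM0).trans_eq (mul_one M)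
  have hprod : ∀ n, Continuous fun x ↦ H x * χ n x := by
    intro n
    rw [continuous_iff_continuousAt]
    intro x
    by_cases hx : D x = 0
    · have hχx : χ n x = 0 := by simp [χ, hx]
      have h2 : Tendsto (fun y ↦ M * χ n y) (𝓝 x) (𝓝 0) := by
        have := (hχc n).continuousAt (x := x) |>.const_mul M
        simpa [ContinuousAt, hχx] using this
      rw [ContinuousAt, hχx, mul_zero]
      refine squeeze_zero_norm (fun y ↦ ?_) h2
      rw [Real.norm_eq_abs, abs_mul, abs_of_nonneg (hχ0 n y)]
      exact mul_le_mul_of_nonneg_right (hM y) (hχ0 n y)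
    · exact (hH x hx).mul (hχc n).continuousAt
  have hint1 : Tendsto (fun n : ℕ ↦ ∫ x in Icc (0 : ℝ) 1, (1 - χ n x)) atTop (𝓝 0) := by
    have := tendsto_integral_of_dominated_convergence (μ := volume.restrict (Icc (0 : ℝ) 1))
      (F := fun n x ↦ 1 - χ n x) (f := fun _ ↦ 0) (fun _ ↦ 1)
      (fun n ↦ (by fun_prop : Continuous fun x ↦ 1 - χ n x).aestronglyMeasurable)
      (integrable_const _) (fun n ↦ ae_of_all _ fun x ↦ ?_) ?_
    · simpa using this
    · rw [Real.norm_eq_abs, abs_of_nonneg (by linarith [hχ1 n x])]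
      linarith [hχ0 n x]
    · filter_upwards [hDae] with x hx
      have hx' : 0 < D x := (hD0 x).lt_of_ne' hx
      refine tendsto_const_nhds.congr' ?_
      filter_upwards [eventually_ge_atTop ⌈(D x)⁻¹⌉₊] with n hn
      have : 1 ≤ n * D x := by
        rw [← inv_mul_cancel₀ hx]
        gcongr
        exact Nat.ceil_le.mp hn
      simp [χ, this]
  refine tendsto_of_forall_approx fun ε hε ↦ ?_
  obtain ⟨n, hn⟩ := (hint1.eventually_lt_const
    (show (0 : ℝ) < ε / (M + 1) by positivity)).exists
  have hdiff : ∀ x, |H x - H x * χ n x| ≤ M * (1 - χ n x) := fun x ↦ by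
    rw [← mul_one_sub, abs_mul, abs_of_nonneg (a := 1 - χ n x) (by linarith [hχ1 n x])]
    exact mul_le_mul_of_nonneg_right (hM x) (by linarith [hχ1 n x])
  have hMε : M * (ε / (M + 1)) ≤ ε := by
    rw [← mul_div_assoc, div_le_iff₀ (by positivity)]
    nlinarith
  refine ⟨_, _, tendsto_average_coprime_continuous (hprod n) (hprodM n), ?_, ?_⟩
  · have hc : Continuous fun x ↦ 1 - χ n x := by fun_prop
    have := tendsto_average_coprime_continuous hc (M := 1) fun x ↦ by
      rw [abs_of_nonneg (by linarith [hχ1 n x])]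
      linarith [hχ0 n x]
    filter_upwards [this.eventually_lt_const hn] with q hq
    rw [← sub_div, ← Finset.sum_sub_distrib, abs_div, Nat.abs_cast]
    calc _ ≤ (∑ b ∈ (Finset.Icc 1 q).filter (fun b ↦ Nat.Coprime b q),
            M * (1 - χ n (b / q))) / (q.totient : ℝ) := by
          gcongr
          exact (Finset.abs_sum_le_sum_abs _ _).trans (Finset.sum_le_sum fun b _ ↦ hdiff _)
      _ ≤ M * (ε / (M + 1)) := by
          rw [← Finset.mul_sum, mul_div_assoc]
          gcongr
      _ ≤ ε := hMε
  · have hi1 : Integrable H (volume.restrict (Icc (0 : ℝ) 1)) :=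
      Integrable.of_bound hHm.aestronglyMeasurable M (ae_of_all _ hM)
    have hi2 : Integrable (fun x ↦ H x * χ n x) (volume.restrict (Icc (0 : ℝ) 1)) :=
      Integrable.of_bound (hprod n).aestronglyMeasurable M (ae_of_all _ (hprodM n))
    have hi3 : Integrable (fun x ↦ 1 - χ n x) (volume.restrict (Icc (0 : ℝ) 1)) :=
      (continuous_const.sub (hχc n)).continuousOn.integrableOn_Icc
    rw [← integral_sub hi1 hi2]
    calc _ ≤ ∫ x in Icc (0 : ℝ) 1, |H x - H x * χ n x| := abs_integral_le_integral_abs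
      _ ≤ ∫ x in Icc (0 : ℝ) 1, M * (1 - χ n x) :=
        integral_mono (hi1.sub hi2).abs (hi3.const_mul M) hdiff
      _ ≤ M * (ε / (M + 1)) := by
        rw [integral_const_mul]
        gcongr
      _ ≤ ε := hMε

lemma sin_pi_mul_ne_zero_of_irrational {x : ℝ} (hx : Irrational x) {k : ℕ} (hk : k ≠ 0) :
    Real.sin (Real.pi * (k * x)) ≠ 0 := by
  rw [Real.sin_ne_zero_iff]
  intro n hn
  rw [mul_comm] at hn
  exact (hx.natCast_mul hk).ne_int n (mul_left_cancel₀ Real.pi_ne_zero hn).symm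

lemma ae_irrational (μ : Measure ℝ) [NullSingletonClass μ] : ∀ᵐ x ∂μ, Irrational x :=
  (countable_range ((↑) : ℚ → ℝ)).ae_notMem μ

lemma abs_sub_le_rpow_of_lipschitzWith {X : Type*} [PseudoMetricSpace X] {f : X → ℝ} {C : ℝ}
    {L : NNReal} (hC : ∀ x y, dist (f x) (f y) ≤ C) (hL : LipschitzWith L f) {p : ℝ} (hp0 : 0 < p)
    (hp : p ≤ 1) (x y : X) : |f x - f y| ≤ max C L * dist x y ^ p := by
  rw [← Real.dist_eq]
  rcases le_total (dist x y) 1 with h | h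
  · calc _ ≤ L * dist x y := hL.dist_le_mul x y
      _ ≤ max C L * dist x y ^ p := by
        gcongr
        · exact le_max_right _ _
        · simpa using Real.rpow_le_rpow_of_exponent_ge' dist_nonneg h hp0.le hp
  · have hC0 : 0 ≤ C := dist_nonneg.trans (hC x y)
    calc _ ≤ C * 1 := by simpa using hC x y
      _ ≤ max C L * dist x y ^ p := by
        gcongr
        · exact le_max_left _ _
        · exact Real.one_le_rpow h hp0.le

lemma measurable_cotSum (w : ℕ → ℂ) (K : ℕ) : Measurable fun x : ℝ ↦
    ∑ k ∈ Finset.range K, w k * ((Real.cot (Real.pi * (k * x)) : ℝ) : ℂ) := by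
  simp only [Real.cot_eq_cos_div_sin]
  fun_prop

lemma tendsto_average_coprime_comp_cotSum (w : ℕ → ℂ) (K : ℕ) {f : ℂ → ℝ} (hf : Continuous f)
    {M : ℝ} (hM : ∀ z, |f z| ≤ M) :
    Tendsto (fun q : ℕ ↦ (∑ b ∈ (Finset.Icc 1 q).filter (fun b ↦ Nat.Coprime b q),
      f (∑ k ∈ Finset.range K, w k * ((Real.cot (Real.pi * (k * (b / q : ℝ))) : ℝ) : ℂ)))
        / (q.totient : ℝ)) atTop
      (𝓝 (∫ x in Icc (0 : ℝ) 1,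
        f (∑ k ∈ Finset.range K, w k * ((Real.cot (Real.pi * (k * x)) : ℝ) : ℂ)))) := by
  refine tendsto_average_coprime_of_ae_continuousAt
    (H := fun x ↦ f (∑ k ∈ Finset.range K, w k * ((Real.cot (Real.pi * (k * x)) : ℝ) : ℂ)))
    (D := fun x ↦ ∏ k ∈ (Finset.range K).erase 0, |Real.sin (Real.pi * (k * x))|)
    (M := M) (fun x ↦ hM _) (hf.measurable.comp (measurable_cotSum w K)) (by fun_prop)
    (fun x ↦ Finset.prod_nonneg fun _ _ ↦ abs_nonneg _) ?_ fun x hx ↦ ?_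
  · filter_upwards [ae_irrational _] with x hx
    refine Finset.prod_ne_zero_iff.mpr fun k hk ↦ abs_ne_zero.mpr ?_
    exact sin_pi_mul_ne_zero_of_irrational hx (Finset.ne_of_mem_erase hk)
  · rw [Finset.prod_ne_zero_iff] at hx
    refine hf.continuousAt.comp (tendsto_finsetSum _ fun k hk ↦ ?_)
    simp only [Real.cot_eq_cos_div_sin]
    rcases eq_or_ne k 0 with rfl | hk0
    · simp
    · have := abs_ne_zero.mp (hx k (Finset.mem_erase.mpr ⟨hk0, hk⟩))
      refine ContinuousAt.tendsto (f := fun x : ℝ ↦ w k *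
        ((Real.cos (Real.pi * (k * x)) / Real.sin (Real.pi * (k * x)) : ℝ) : ℂ)) ?_
      refine continuousAt_const.mul (Complex.continuous_ofReal.continuousAt.comp ?_)
      exact ContinuousAt.div (by fun_prop) (by fun_prop) this

theorem tendsto_average_coprime_comp_cotSeries {p : ℝ} {w : ℕ → ℂ} (hp0 : 0 < p) (hp : p < 1)
    (hw : Summable fun k ↦ ‖w k‖ ^ p) {G : ℂ → ℝ} (hG : Continuous G) {M : ℝ}
    (hM : ∀ z, |G z| ≤ M) :
    Tendsto (fun q : ℕ ↦ (∑ b ∈ (Finset.Icc 1 q).filter (fun b ↦ Nat.Coprime b q),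
      G (cotSeries w (b / q))) / (q.totient : ℝ)) atTop
      (𝓝 (∫ x in Icc (0 : ℝ) 1, G (cotSeries w x))) := by
  have hae := aemeasurable_cotSeries hp0 hp hw
  have hmap : ∀ f : ℂ → ℝ, Continuous f →
      ∫ z, f z ∂(volume.restrict (Icc (0 : ℝ) 1)).map (cotSeries w) =
        ∫ x in Icc (0 : ℝ) 1, f (cotSeries w x) := fun f hf ↦
    integral_map hae hf.measurable.aestronglyMeasurable
  have := Measure.isProbabilityMeasure_map hae
  have key := tendsto_average_of_lipschitz (X := ℂ)
    (s := fun q ↦ (Finset.Icc 1 q).filter (fun b ↦ Nat.Coprime b q))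
    (z := fun q b ↦ cotSeries w (b / q))
    (ν := (volume.restrict (Icc (0 : ℝ) 1)).map (cotSeries w)) ?_ ?_ hG hM
  · rw [hmap G hG] at key
    simpa only [sum_coprime_one] using key
  · filter_upwards [eventually_ne_atTop 0] with q hq
    rw [← Finset.card_pos, sum_coprime_one]
    exact Nat.totient_pos.mpr (Nat.pos_of_ne_zero hq)
  rintro f ⟨C, hC⟩ ⟨L, hL⟩
  rw [hmap f hL.continuous]
  simp only [sum_coprime_one]
  have hfM : ∀ z, |f z| ≤ |f 0| + C := fun z ↦ by
    have := hC z 0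
    rw [Real.dist_eq] at this
    linarith [abs_sub_abs_le_abs_sub (f z) (f 0)]
  have hA := abs_sub_le_rpow_of_lipschitzWith hC hL hp0 hp.le
  set A : ℝ := max C L with hAdef
  have hA0 : 0 ≤ A := le_max_of_le_right L.2
  obtain ⟨B, hB0, hB⟩ := exists_sum_coprime_cosecSeries_le hp0 hp
  set J : ℝ := ∫ x in Icc (0 : ℝ) 1, cosecAbs x ^ p
  have hlim1 : Tendsto (fun K ↦ A * (B * ∑' k, ‖tailWeight w K k‖ ^ p)) atTop (𝓝 0) := by
    simpa using ((tendsto_tsum_norm_tailWeight_rpow hp0 hw).const_mul B).const_mul A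
  have hlim2 : Tendsto (fun K ↦ A * (J * ∑' k, ‖tailWeight w K k‖ ^ p)) atTop (𝓝 0) := by
    simpa using ((tendsto_tsum_norm_tailWeight_rpow hp0 hw).const_mul J).const_mul A
  refine tendsto_of_forall_approx fun ε hε ↦ ?_
  obtain ⟨K, hK1, hK2⟩ := ((hlim1.eventually_le_const hε).and (hlim2.eventually_le_const hε)).exists
  have hwK := summable_norm_tailWeight_rpow hp0 hw K
  have hdiff : ∀ x, (Summable fun k : ℕ ↦ ‖w k‖ ^ p * cosecAbs (k * x) ^ p) →
      |f (cotSeries w x) -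
        f (∑ k ∈ Finset.range K, w k * ((Real.cot (Real.pi * (k * x)) : ℝ) : ℂ))| ≤
        A * cosecSeries p (tailWeight w K) x := fun x hx ↦ by
    refine (hA _ _).trans ?_
    rw [dist_eq_norm, cotSeries_sub_sum_range hp0 hp.le hx]
    gcongr
    exact norm_cotSeries_rpow_le hp0 hp.le (summable_tailWeight_cosecAbs hp0 hx K)
  refine ⟨_, _, tendsto_average_coprime_comp_cotSum w K hL.continuous hfM, ?_, ?_⟩
  · filter_upwards [eventually_ne_atTop 0] with q hq
    have hφ : (0 : ℝ) < q.totient := by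
      exact_mod_cast Nat.totient_pos.mpr (Nat.pos_of_ne_zero hq)
    rw [← sub_div, ← Finset.sum_sub_distrib, abs_div, Nat.abs_cast, div_le_iff₀ hφ]
    calc _ ≤ ∑ b ∈ (Finset.Icc 1 q).filter (fun b ↦ Nat.Coprime b q),
            A * cosecSeries p (tailWeight w K) (b / q) :=
          (Finset.abs_sum_le_sum_abs _ _).trans
            (Finset.sum_le_sum fun b hb ↦ hdiff _ ((hB w hw q hq).1 b hb))
      _ ≤ A * ((B * ∑' k, ‖tailWeight w K k‖ ^ p) * q.totient) := by
          rw [← Finset.mul_sum]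
          exact mul_le_mul_of_nonneg_left (hB _ hwK q hq).2 hA0
      _ ≤ ε * q.totient := by
          rw [← mul_assoc]
          gcongr
  · have hi1 : Integrable (fun x ↦ f (cotSeries w x)) (volume.restrict (Icc (0 : ℝ) 1)) :=
      Integrable.of_bound (hL.continuous.measurable.comp_aemeasurable hae).aestronglyMeasurable
        (|f 0| + C) (ae_of_all _ fun x ↦ hfM _)
    have hi2 : Integrable (fun x ↦ f (∑ k ∈ Finset.range K,
        w k * ((Real.cot (Real.pi * (k * x)) : ℝ) : ℂ))) (volume.restrict (Icc (0 : ℝ) 1)) :=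
      Integrable.of_bound
        (hL.continuous.measurable.comp (measurable_cotSum w K)).aestronglyMeasurable
        (|f 0| + C) (ae_of_all _ fun x ↦ hfM _)
    rw [← integral_sub hi1 hi2]
    calc _ ≤ ∫ x in Icc (0 : ℝ) 1, |f (cotSeries w x) - f (∑ k ∈ Finset.range K,
            w k * ((Real.cot (Real.pi * (k * x)) : ℝ) : ℂ))| := abs_integral_le_integral_abs
      _ ≤ ∫ x in Icc (0 : ℝ) 1, A * cosecSeries p (tailWeight w K) x := by
        refine integral_mono_ae (hi1.sub hi2).abs
          ((integrableOn_cosecSeries hp0 hp hwK).const_mul A) ?_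
        filter_upwards [ae_summable_cosecAbs hp0 hp hw] with x hx using hdiff x hx
      _ ≤ A * (J * ∑' k, ‖tailWeight w K k‖ ^ p) := by
        rw [integral_const_mul]
        exact mul_le_mul_of_nonneg_left (setIntegral_cosecSeries_le hp0 hp hwK) hA0
      _ ≤ ε := hK2

lemma cot_pi_mul_residue (j m b q : ℕ) (hq : q ≠ 0) :
    Real.cot (Real.pi * ((j + q * m : ℕ) * (b / q : ℝ))) = Real.cot (Real.pi * j * b / q) := by
  have hq' : (q : ℝ) ≠ 0 := by positivity
  have : Real.pi * ((j + q * m : ℕ) * (b / q : ℝ)) =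
      Real.pi * j * b / q + (m * b : ℕ) * Real.pi := by
    push_cast
    field_simp
  rw [this, Real.cot_eq_cos_div_sin, Real.cot_eq_cos_div_sin, Real.cos_add_nat_mul_pi,
    Real.sin_add_nat_mul_pi, mul_div_mul_left _ _ (by positivity)]

lemma natCast_cpow_residue (a : ℂ) (j m q : ℕ) (hq : q ≠ 0) :
    ((j + q * m : ℕ) : ℂ) ^ a = ((q : ℝ) : ℂ) ^ a * ((m : ℂ) + ((j / q : ℝ) : ℂ)) ^ a := by
  have hq' : (q : ℂ) ≠ 0 := by exact_mod_cast hq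
  have h := Complex.mul_cpow_ofReal_nonneg (a := (q : ℝ)) (b := m + j / q)
    (by positivity) (by positivity) a
  push_cast at h ⊢
  rw [← h]
  congr 1
  field_simp
  ring

lemma cotanSum_eq_cotSeries {a : ℂ} {b q : ℕ} (hq : q ≠ 0)
    (hs : Summable fun k : ℕ ↦
      (k : ℂ) ^ a * ((Real.cot (Real.pi * (k * (b / q : ℝ))) : ℝ) : ℂ)) :
    cotanSum a b q = cotSeries (fun k ↦ (k : ℂ) ^ a) (b / q) := by
  have : NeZero q := ⟨hq⟩
  let g : ℕ → ℂ := fun j ↦ ∑' m : ℕ, ((j + q * m : ℕ) : ℂ) ^ a *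
    ((Real.cot (Real.pi * ((j + q * m : ℕ) * (b / q : ℝ))) : ℝ) : ℂ)
  have hg : ∀ j, g j = ((q : ℝ) : ℂ) ^ a *
      (((Real.cot (Real.pi * j * b / q) : ℝ) : ℂ) * hzetaSeries (-a) ((j : ℝ) / q)) := by
    intro j
    simp only [g, cot_pi_mul_residue _ _ _ _ hq, natCast_cpow_residue _ _ _ _ hq]
    rw [tsum_mul_right, tsum_mul_left, hzetaSeries, neg_neg]
    ring
  have hsum : ∑ j : ZMod q, g j.val = ∑ j ∈ Finset.range q, g j := by
    obtain ⟨n, rfl⟩ := Nat.exists_eq_succ_of_ne_zero hq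
    exact Fin.sum_univ_eq_sum_range g (n + 1)
  rw [cotSeries, Nat.sumByResidueClasses hs q]
  refine Eq.trans ?_ hsum.symm
  rw [Finset.sum_range_eq_add_Ico _ (Nat.pos_of_ne_zero hq), hg 0]
  simp only [hg, cotanSum, Finset.mul_sum]
  simp [Complex.cot]

lemma exists_forall_le_circleAverage_log_norm {g : ℂ → ℂ}
    (hg : AnalyticOnNhd ℂ g (Metric.ball 0 1)) :
    ∃ C, ∀ r : ℝ, 1 / 2 ≤ r → r < 1 → C ≤ Real.circleAverage (fun z ↦ Real.log ‖g z‖) 0 r := by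
  refine ⟨(meromorphicOrderAt g 0).untop₀ * Real.log (1 / 2) +
    Real.log ‖meromorphicTrailingCoeffAt g 0‖, fun r hr hr1 ↦ ?_⟩
  have hr0 : 0 < r := by linarith
  have hg' : AnalyticOnNhd ℂ g (Metric.closedBall 0 |r|) :=
    hg.mono (Metric.closedBall_subset_ball (by rwa [abs_of_pos hr0]))
  rw [MeromorphicOn.circleAverage_log_norm hr0.ne' hg'.meromorphicOn, 
    MeromorphicOn.divisor_apply hg'.meromorphicOn (by simp)]
  have hord : (0 : ℤ) ≤ (meromorphicOrderAt g 0).untop₀ := by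
    rw [← MeromorphicOn.divisor_apply hg'.meromorphicOn (by simp)]
    exact MeromorphicOn.AnalyticOnNhd.divisor_nonneg hg' 0
  have hsum : 0 ≤ ∑ᶠ u, (MeromorphicOn.divisor g (Metric.closedBall 0 |r|) u : ℝ) *
      Real.log (r * ‖(0 : ℂ) - u‖⁻¹) := by
    refine finsum_nonneg fun u ↦ ?_
    by_cases hu : u ∈ Metric.closedBall (0 : ℂ) |r|
    · refine mul_nonneg (mod_cast MeromorphicOn.AnalyticOnNhd.divisor_nonneg hg' u) ?_
      rcases eq_or_ne u 0 with rfl | hu0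
      · simp
      · rw [mem_closedBall_zero_iff, abs_of_pos hr0] at hu
        refine Real.log_nonneg ?_
        rw [zero_sub, norm_neg, ← div_eq_mul_inv, one_le_div (norm_pos_iff.mpr hu0)]
        exact hu
    · simp [hu]
  have hlog : Real.log (1 / 2) ≤ Real.log r := Real.log_le_log (by norm_num) hr
  have : ((meromorphicOrderAt g 0).untop₀ : ℝ) * Real.log (1 / 2) ≤
      (meromorphicOrderAt g 0).untop₀ * Real.log r :=
    mul_le_mul_of_nonneg_left hlog (mod_cast hord)
  linarith

lemma exists_forall_le_circleAverage_log_max {g : ℂ → ℂ}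
    (hg : AnalyticOnNhd ℂ g (Metric.ball 0 1)) (hg0 : ¬ EqOn g 0 (Metric.ball 0 1)) :
    ∃ C, ∀ ε > 0, ∀ r : ℝ, 1 / 2 ≤ r → r < 1 →
      C ≤ Real.circleAverage (fun z ↦ Real.log (max ‖g z‖ ε)) 0 r := by
  obtain ⟨C, hC⟩ := exists_forall_le_circleAverage_log_norm hg
  refine ⟨C, fun ε hε r hr hr1 ↦ (hC r hr hr1).trans ?_⟩
  have hr0 : 0 < r := by linarith
  have hsub : Metric.sphere (0 : ℂ) |r| ⊆ Metric.ball 0 1 :=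
    Metric.sphere_subset_closedBall.trans
      (Metric.closedBall_subset_ball (by rwa [abs_of_pos hr0]))
  have hne := (hg.eqOn_zero_or_eventually_ne_zero_of_preconnected
    (convex_ball (0 : ℂ) 1).isPreconnected).resolve_left hg0
  have hcongr : (fun z ↦ Real.log ‖g z‖) =ᶠ[codiscreteWithin (Metric.sphere 0 |r|)]
      fun z ↦ if g z = 0 then Real.log ε else Real.log ‖g z‖ := by
    filter_upwards [codiscreteWithin_mono hsub hne] with z hz
    rw [if_neg hz]
  have hint := ((hg.mono hsub).meromorphicOn).circleIntegrable_log_norm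
  rw [Real.circleAverage_congr_codiscreteWithin hcongr hr0.ne']
  refine Real.circleAverage_mono (hint.congr_codiscreteWithin hcongr) ?_ fun z _ ↦ ?_
  · refine ContinuousOn.circleIntegrable' ?_
    refine ContinuousOn.log ?_ fun z _ ↦ (lt_max_of_lt_right hε).ne'
    exact ((hg.mono hsub).continuousOn.norm).sup continuousOn_const
  · split_ifs with h
    · exact Real.log_le_log hε (le_max_right _ _)
    · exact Real.log_le_log (norm_pos_iff.mpr h) (le_max_left _ _)

lemma circleAverage_eq_setIntegral (f : ℂ → ℝ) (r : ℝ) :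
    Real.circleAverage f 0 r =
      ∫ x in Icc (0 : ℝ) 1, f (circleMap 0 r (2 * Real.pi * x)) := by
  rw [Real.circleAverage_def, integral_Icc_eq_integral_Ioc,
    ← intervalIntegral.integral_of_le zero_le_one,
    intervalIntegral.integral_comp_mul_left (fun θ ↦ f (circleMap 0 r θ)) (by positivity)]
  simp

lemma log_max_le_rpow_div {p y : ℝ} (hp : 0 < p) (hy : 0 ≤ y) :
    Real.log (max y 1) ≤ y ^ p / p := by
  rcases le_total y 1 with h | h
  · rw [max_eq_right h, Real.log_one]
    positivity
  · rw [max_eq_left h]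
    exact Real.log_le_rpow_div hy hp

lemma abs_log_max_le {p y ε : ℝ} (hp : 0 < p) (hy : 0 ≤ y) (hε : 0 < ε) (hε1 : ε ≤ 1) :
    |Real.log (max y ε)| ≤ -Real.log ε + y ^ p / p := by
  have h1 : Real.log (max y ε) ≤ Real.log (max y 1) :=
    Real.log_le_log (lt_max_of_lt_right hε) (max_le_max le_rfl hε1)
  have h2 : Real.log ε ≤ Real.log (max y ε) := Real.log_le_log hε (le_max_right _ _)
  have h3 := log_max_le_rpow_div hp hy
  have h4 := Real.log_nonpos hε.le hε1
  have h5 : 0 ≤ y ^ p / p := by positivity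
  rw [abs_le]
  constructor <;> linarith

/-- A uniqueness theorem of F. and M. Riesz type: the radial limits of a nonzero holomorphic
function dominated by a power-integrable function vanish only on a null set. -/
theorem volume_radialLimit_eq_zero {g : ℂ → ℂ} (hg : AnalyticOnNhd ℂ g (Metric.ball 0 1))
    (hg0 : ¬ EqOn g 0 (Metric.ball 0 1)) {f : ℝ → ℂ} (hf : Measurable f) {p : ℝ} (hp : 0 < p)
    {Φ : ℝ → ℝ} (hΦ : IntegrableOn Φ (Icc 0 1))
    (hlim : ∀ᵐ x ∂volume.restrict (Icc (0 : ℝ) 1),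
      Tendsto (fun r ↦ g (circleMap 0 r (2 * Real.pi * x))) (𝓝[<] 1) (𝓝 (f x)))
    (hbound : ∀ᵐ x ∂volume.restrict (Icc (0 : ℝ) 1), ∀ r : ℝ, 1 / 2 ≤ r → r < 1 →
      ‖g (circleMap 0 r (2 * Real.pi * x))‖ ^ p ≤ Φ x) :
    volume {x ∈ Icc (0 : ℝ) 1 | f x = 0} = 0 := by
  obtain ⟨C, hC⟩ := exists_forall_le_circleAverage_log_max hg hg0
  let r : ℕ → ℝ := fun n ↦ 1 - 1 / (n + 2)
  have hr2 : ∀ n, 1 / 2 ≤ r n := fun n ↦ by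
    have : 1 / ((n : ℝ) + 2) ≤ 1 / 2 := by gcongr; linarith [n.cast_nonneg (α := ℝ)]
    simp only [r]
    linarith
  have hr1 : ∀ n, r n < 1 := fun n ↦ by
    have : 0 < 1 / ((n : ℝ) + 2) := by positivity
    simp only [r]
    linarith
  have hr : Tendsto r atTop (𝓝[<] 1) := by
    refine tendsto_nhdsWithin_iff.mpr ⟨?_, Eventually.of_forall hr1⟩
    have h := tendsto_one_div_add_atTop_nhds_zero_nat (𝕜 := ℝ)
    have := ((tendsto_add_atTop_iff_nat 1).mpr h).const_sub 1
    simp only [sub_zero] at this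
    refine this.congr fun n ↦ ?_
    simp only [r]
    push_cast
    ring
  have hlim' : ∀ᵐ x ∂volume.restrict (Icc (0 : ℝ) 1),
      Tendsto (fun n ↦ g (circleMap 0 (r n) (2 * Real.pi * x))) atTop (𝓝 (f x)) :=
    hlim.mono fun x hx ↦ hx.comp hr
  have hfΦ : ∀ᵐ x ∂volume.restrict (Icc (0 : ℝ) 1), ‖f x‖ ^ p ≤ Φ x := by
    filter_upwards [hlim', hbound] with x hx hb
    exact le_of_tendsto (hx.norm.rpow_const (Or.inr hp.le))
      (Eventually.of_forall fun n ↦ hb _ (hr2 n) (hr1 n))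
  have hcont : ∀ n, Continuous fun x : ℝ ↦ g (circleMap 0 (r n) (2 * Real.pi * x)) := by
    intro n
    have h0 : 0 ≤ r n := by linarith [hr2 n]
    refine hg.continuousOn.comp_continuous (by fun_prop) fun x ↦ ?_
    rw [mem_ball_zero_iff, norm_circleMap_zero, abs_of_nonneg h0]
    exact hr1 n
  set A : Set ℝ := {x | f x = 0} with hA
  have hAm : MeasurableSet A := hf (measurableSet_singleton 0)
  have key : ∀ ε, 0 < ε → ε ≤ 1 →
      C ≤ (volume.restrict (Icc (0 : ℝ) 1)).real A * Real.log ε +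
        (∫ x in Icc (0 : ℝ) 1, Φ x) / p := by
    intro ε hε hε1
    have hcl : Continuous fun y : ℝ ↦ Real.log (max y ε) :=
      (continuous_id.max continuous_const).log fun y ↦ (lt_max_of_lt_right hε).ne'
    have hDCT := tendsto_integral_of_dominated_convergence
      (μ := volume.restrict (Icc (0 : ℝ) 1))
      (F := fun n x ↦ Real.log (max ‖g (circleMap 0 (r n) (2 * Real.pi * x))‖ ε))
      (f := fun x ↦ Real.log (max ‖f x‖ ε)) (fun x ↦ -Real.log ε + Φ x / p)
      (fun n ↦ (hcl.comp (hcont n).norm).aestronglyMeasurable)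
      ((integrable_const _).add (hΦ.div_const p)) (fun n ↦ ?_) ?_
    · have h1 : C ≤ ∫ x in Icc (0 : ℝ) 1, Real.log (max ‖f x‖ ε) := by
        refine ge_of_tendsto' hDCT fun n ↦ ?_
        rw [← circleAverage_eq_setIntegral (fun z ↦ Real.log (max ‖g z‖ ε))]
        exact hC ε hε (r n) (hr2 n) (hr1 n)
      have hAi : IntegrableOn (A.indicator fun _ ↦ Real.log ε) (Icc (0 : ℝ) 1) :=
        (integrable_const _).indicator hAm
      calc C ≤ ∫ x in Icc (0 : ℝ) 1, Real.log (max ‖f x‖ ε) := h1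
        _ ≤ ∫ x in Icc (0 : ℝ) 1, (A.indicator (fun _ ↦ Real.log ε) x + Φ x / p) := by
          refine integral_mono_ae ?_ (hAi.add (hΦ.div_const p)) ?_
          · refine Integrable.mono' ((integrable_const (-Real.log ε)).add (hΦ.div_const p))
              (hcl.measurable.comp hf.norm).aestronglyMeasurable ?_
            filter_upwards [hfΦ] with x hx
            refine (abs_log_max_le hp (norm_nonneg _) hε hε1).trans ?_
            simp only [Pi.add_apply]
            gcongr
          · filter_upwards [hfΦ] with x hx
            by_cases hxA : x ∈ A
            · have hΦ0 : 0 ≤ Φ x := le_trans (by positivity) hx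
              have hfx : f x = 0 := hxA
              simp only [indicator_of_mem hxA, hfx, norm_zero, max_eq_right hε.le]
              have : 0 ≤ Φ x / p := by positivity
              linarith
            · simp only [indicator_of_notMem hxA, zero_add]
              refine le_trans (Real.log_le_log (lt_max_of_lt_right hε) (max_le_max le_rfl hε1))
                ((log_max_le_rpow_div hp (norm_nonneg _)).trans ?_)
              gcongr
        _ = _ := by
          rw [integral_add hAi (hΦ.div_const p), integral_indicator hAm, integral_div]
          simp [Measure.real]
    · filter_upwards [hbound] with x hx
      refine (abs_log_max_le hp (norm_nonneg _) hε hε1).trans ?_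
      have := hx (r n) (hr2 n) (hr1 n)
      gcongr
    · filter_upwards [hlim'] with x hx
      exact (hcl.tendsto _).comp hx.norm
  have hzero : (volume.restrict (Icc (0 : ℝ) 1)).real A = 0 := by
    by_contra hne
    have hpos : 0 < (volume.restrict (Icc (0 : ℝ) 1)).real A :=
      lt_of_le_of_ne measureReal_nonneg (Ne.symm hne)
    have hbot : Tendsto (fun ε ↦ (volume.restrict (Icc (0 : ℝ) 1)).real A * Real.log ε +
        (∫ x in Icc (0 : ℝ) 1, Φ x) / p) (𝓝[>] 0) atBot :=
      tendsto_atBot_add_const_right _ _ (Real.tendsto_log_nhdsGT_zero.const_mul_atBot hpos)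
    obtain ⟨ε, h1, h2, h3⟩ := ((hbot.eventually_lt_atBot C).and
      (Ioo_mem_nhdsGT (zero_lt_one (α := ℝ)))).exists
    exact absurd (key ε h2 h3.le) (not_le.mpr h1)
  rw [measureReal_eq_zero_iff, Measure.restrict_apply hAm, inter_comm] at hzero
  exact hzero

/-- The function with `cotKernel (exp (2 π i t)) = cot (π t)`. -/
noncomputable def cotKernel (v : ℂ) : ℂ := (v + 1) / (Complex.I * (1 - v))

lemma cotKernel_one : cotKernel 1 = 0 := by simp [cotKernel]

lemma cotKernel_exp (t : ℝ) : cotKernel (Complex.exp ((2 * Real.pi * t : ℝ) * Complex.I)) =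
    ((Real.cot (Real.pi * t) : ℝ) : ℂ) := by
  rw [Complex.ofReal_cot, Complex.cot_eq_exp_ratio, cotKernel]
  push_cast
  ring_nf

lemma cotKernel_sub_cotKernel_zero {v : ℂ} (hv : v ≠ 1) :
    cotKernel v - cotKernel 0 = -2 * Complex.I * (v / (1 - v)) := by
  have h : 1 - v ≠ 0 := sub_ne_zero.mpr hv.symm
  simp only [cotKernel]
  field_simp
  rw [Complex.I_sq]
  ring

lemma differentiableAt_cotKernel {v : ℂ} (hv : v ≠ 1) : DifferentiableAt ℂ cotKernel v := by
  unfold cotKernel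
  exact (by fun_prop : DifferentiableAt ℂ (fun v : ℂ ↦ v + 1) v).fun_div (by fun_prop)
    (mul_ne_zero Complex.I_ne_zero (sub_ne_zero.mpr hv.symm))

lemma norm_cotKernel_le {v : ℂ} (hv : ‖v‖ ≤ 1) {δ : ℝ} (hδ : 0 < δ) (h : δ ≤ ‖1 - v‖) :
    ‖cotKernel v‖ ≤ 2 / δ := by
  rw [cotKernel, norm_div, norm_mul, Complex.norm_I, one_mul]
  gcongr
  exact (norm_add_le _ _).trans (by rw [norm_one]; linarith)

lemma norm_one_sub_le_two_mul {e : ℂ} (he : ‖e‖ = 1) {ρ : ℝ} (hρ0 : 0 ≤ ρ) (hρ : ρ ≤ 1) :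
    ‖1 - e‖ ≤ 2 * ‖1 - ρ * e‖ := by
  have hn : ‖(ρ : ℂ) * e‖ = ρ := by simp [he, abs_of_nonneg hρ0]
  have h1 : 1 - ρ ≤ ‖1 - ρ * e‖ := by
    have := norm_sub_norm_le (1 : ℂ) (ρ * e)
    rwa [hn, norm_one] at this
  have h2 : ‖((ρ : ℂ) - 1) * e‖ = 1 - ρ := by
    rw [norm_mul, he, mul_one, ← Complex.ofReal_one, ← Complex.ofReal_sub, Complex.norm_real,
      Real.norm_eq_abs, abs_of_nonpos (by linarith)]
    ring
  calc ‖1 - e‖ = ‖(1 - ρ * e) + ((ρ : ℂ) - 1) * e‖ := by ring_nf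
    _ ≤ ‖1 - ρ * e‖ + ‖((ρ : ℂ) - 1) * e‖ := norm_add_le _ _
    _ ≤ _ := by linarith

lemma norm_cotKernel_mul_exp_le {t ρ : ℝ} (ht : Real.sin (Real.pi * t) ≠ 0) (hρ0 : 0 ≤ ρ)
    (hρ : ρ ≤ 1) :
    ‖cotKernel (ρ * Complex.exp ((2 * Real.pi * t : ℝ) * Complex.I))‖ ≤ 2 * cosecAbs t := by
  have he := Complex.norm_exp_ofReal_mul_I (2 * Real.pi * t)
  rw [cosecAbs, ← div_eq_mul_inv]
  refine norm_cotKernel_le ?_ (abs_pos.mpr ht) ?_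
  · rw [norm_mul, he]
    simpa [abs_of_nonneg hρ0] using hρ
  · have h1 := norm_one_sub_le_two_mul he hρ0 hρ
    have h2 := Complex.norm_exp_I_mul_ofReal_sub_one (2 * Real.pi * t)
    rw [mul_comm Complex.I, norm_sub_rev, norm_mul, Real.norm_eq_abs, Real.norm_eq_abs,
      show 2 * Real.pi * t / 2 = Real.pi * t by ring] at h2
    rw [h2] at h1
    norm_num at h1
    simpa using h1

/-- The holomorphic extension of `cotSeries` to the unit disc. -/
noncomputable def cotDisc (w : ℕ → ℂ) (u : ℂ) : ℂ := ∑' k : ℕ, w k * cotKernel (u ^ k)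

lemma norm_cotKernel_pow_le {u : ℂ} {r : ℝ} (hr : r < 1) (hu : ‖u‖ ≤ r) (k : ℕ) :
    ‖cotKernel (u ^ k)‖ ≤ 2 / (1 - r) := by
  have hr0 : 0 ≤ r := (norm_nonneg _).trans hu
  rcases eq_or_ne k 0 with rfl | hk
  · rw [pow_zero, cotKernel_one, norm_zero]
    exact div_nonneg zero_le_two (by linarith)
  · have hk' : ‖u ^ k‖ ≤ r := by
      rw [norm_pow]
      exact (pow_le_of_le_one (norm_nonneg _) (hu.trans hr.le) hk).trans hu
    refine norm_cotKernel_le (hk'.trans hr.le) (by linarith) ?_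
    have := norm_sub_norm_le (1 : ℂ) (u ^ k)
    rw [norm_one] at this
    linarith

lemma pow_ne_one_of_norm_lt {u : ℂ} (hu : ‖u‖ < 1) {k : ℕ} (hk : k ≠ 0) : u ^ k ≠ 1 := by
  intro h
  have := pow_lt_one₀ (norm_nonneg u) hu hk
  rw [← norm_pow, h, norm_one] at this
  exact this.false

lemma analyticOnNhd_cotDisc {w : ℕ → ℂ} (hw : Summable fun k ↦ ‖w k‖) :
    AnalyticOnNhd ℂ (cotDisc w) (Metric.ball 0 1) := by
  refine DifferentiableOn.analyticOnNhd (fun u hu ↦ ?_) Metric.isOpen_ball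
  rw [mem_ball_zero_iff] at hu
  obtain ⟨r, hur, hr⟩ := exists_between hu
  have hd : DifferentiableOn ℂ (cotDisc w) (Metric.ball 0 r) := by
    refine Complex.differentiableOn_tsum_of_summable_norm (hw.mul_right (2 / (1 - r)))
      (fun k v hv ↦ ?_) Metric.isOpen_ball fun k v hv ↦ ?_
    · rw [mem_ball_zero_iff] at hv
      rcases eq_or_ne k 0 with rfl | hk
      · simp only [pow_zero]
        fun_prop
      · refine (DifferentiableAt.const_mul ?_ _).differentiableWithinAt
        exact (differentiableAt_cotKernel (pow_ne_one_of_norm_lt (hv.trans hr) hk)).fun_comp' v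
          (differentiableAt_pow k)
    · rw [norm_mul]
      gcongr
      exact norm_cotKernel_pow_le hr (mem_ball_zero_iff.mp hv).le k
  exact (hd.differentiableAt
    (Metric.isOpen_ball.mem_nhds (mem_ball_zero_iff.mpr hur))).differentiableWithinAt

lemma norm_mul_cotKernel_circleMap_le {x r : ℝ} (hx : Irrational x) (hr0 : 0 ≤ r) (hr : r ≤ 1)
    (k : ℕ) : ‖cotKernel (circleMap 0 r (2 * Real.pi * x) ^ k)‖ ≤ 2 * cosecAbs (k * x) := by
  rcases eq_or_ne k 0 with rfl | hk
  · rw [pow_zero, cotKernel_one, norm_zero]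
    exact mul_nonneg zero_le_two (cosecAbs_nonneg _)
  · rw [circleMap_zero_pow, circleMap_zero,
      show k * (2 * Real.pi * x) = 2 * Real.pi * (k * x) by ring]
    exact norm_cotKernel_mul_exp_le (sin_pi_mul_ne_zero_of_irrational hx hk) (by positivity)
      (pow_le_one₀ hr0 hr)

lemma tendsto_cotKernel_circleMap {x : ℝ} (hx : Irrational x) (k : ℕ) :
    Tendsto (fun r ↦ cotKernel (circleMap 0 r (2 * Real.pi * x) ^ k)) (𝓝[<] 1)
      (𝓝 ((Real.cot (Real.pi * (k * x)) : ℝ) : ℂ)) := by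
  rcases eq_or_ne k 0 with rfl | hk
  · simp [cotKernel_one, Real.cot_eq_cos_div_sin]
  · rw [← cotKernel_exp]
    have hne : Complex.exp ((2 * Real.pi * (k * x) : ℝ) * Complex.I) ≠ 1 := by
      intro h
      have h2 := Complex.norm_exp_I_mul_ofReal_sub_one (2 * Real.pi * (k * x))
      rw [mul_comm Complex.I, h, sub_self, norm_zero, eq_comm, norm_eq_zero,
        show 2 * Real.pi * (k * x) / 2 = Real.pi * (k * x) by ring] at h2
      exact sin_pi_mul_ne_zero_of_irrational hx hk (by simpa using h2)
    refine (differentiableAt_cotKernel hne).continuousAt.tendsto.comp ?_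
    have : Continuous fun r : ℝ ↦ circleMap 0 r (2 * Real.pi * x) ^ k := by
      simp only [circleMap_zero]
      fun_prop
    convert (this.tendsto 1).mono_left nhdsWithin_le_nhds using 2
    rw [circleMap_zero_pow, circleMap_zero]
    push_cast
    ring_nf

lemma tendsto_cotDisc_circleMap {w : ℕ → ℂ} {x : ℝ} (hx : Irrational x)
    (h : Summable fun k : ℕ ↦ ‖w k‖ * cosecAbs (k * x)) :
    Tendsto (fun r ↦ cotDisc w (circleMap 0 r (2 * Real.pi * x))) (𝓝[<] 1)
      (𝓝 (cotSeries w x)) := by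
  refine tendsto_tsum_of_dominated_convergence (h.mul_left 2)
    (fun k ↦ (tendsto_cotKernel_circleMap hx k).const_mul _) ?_
  filter_upwards [Ioo_mem_nhdsLT (zero_lt_one (α := ℝ))] with r hr k
  rw [norm_mul]
  calc ‖w k‖ * _ ≤ ‖w k‖ * (2 * cosecAbs (k * x)) := by
        gcongr; exact norm_mul_cotKernel_circleMap_le hx hr.1.le hr.2.le k
    _ = _ := by ring

lemma norm_cotDisc_circleMap_rpow_le {p : ℝ} (hp0 : 0 < p) (hp : p ≤ 1) {w : ℕ → ℂ} {x r : ℝ}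
    (hx : Irrational x) (hr0 : 0 ≤ r) (hr : r ≤ 1)
    (h : Summable fun k : ℕ ↦ ‖w k‖ ^ p * cosecAbs (k * x) ^ p) :
    ‖cotDisc w (circleMap 0 r (2 * Real.pi * x))‖ ^ p ≤ 2 ^ p * cosecSeries p w x := by
  have hle : ∀ k : ℕ, ‖w k * cotKernel (circleMap 0 r (2 * Real.pi * x) ^ k)‖ ^ p ≤
      2 ^ p * (‖w k‖ ^ p * cosecAbs (k * x) ^ p) := fun k ↦ by
    rw [norm_mul, Real.mul_rpow (norm_nonneg _) (norm_nonneg _), mul_left_comm,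
      ← Real.mul_rpow zero_le_two (cosecAbs_nonneg _)]
    gcongr
    exact norm_mul_cotKernel_circleMap_le hx hr0 hr k
  have hs := (h.mul_left (2 ^ p)).of_nonneg_of_le (fun _ ↦ by positivity) hle
  refine (norm_tsum_rpow_le hp0 hp hs).trans ?_
  rw [cosecSeries, ← tsum_mul_left]
  exact hs.tsum_le_tsum hle (h.mul_left _)

lemma norm_pow_div_one_sub_pow_le {u : ℂ} (hu0 : u ≠ 0) (hu : ‖u‖ ≤ 1 / 2) {k j : ℕ} (hj : j ≠ 0)
    (hjk : j ≤ k) : ‖u ^ k / (1 - u ^ k) / u ^ j‖ ≤ 2 := by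
  have hk : ‖u ^ k‖ ≤ 1 / 2 := by
    rw [norm_pow]
    exact (pow_le_of_le_one (norm_nonneg _) (by linarith) (by omega)).trans hu
  have h1 : 1 / 2 ≤ ‖1 - u ^ k‖ := by
    have := norm_sub_norm_le (1 : ℂ) (u ^ k)
    rw [norm_one] at this
    linarith
  obtain ⟨m, rfl⟩ := Nat.exists_eq_add_of_le hjk
  have h2 : u ^ (j + m) / (1 - u ^ (j + m)) / u ^ j = u ^ m / (1 - u ^ (j + m)) := by
    rw [pow_add]
    field_simp
  rw [h2, norm_div, norm_pow, div_le_iff₀ (by linarith)]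
  have := pow_le_one₀ (norm_nonneg u) (by linarith : ‖u‖ ≤ 1) (n := m)
  linarith

lemma not_eqOn_cotDisc_const {w : ℕ → ℂ} (hw : Summable fun k ↦ ‖w k‖)
    (hne : ∃ k, k ≠ 0 ∧ w k ≠ 0) (c : ℂ) :
    ¬ EqOn (fun u ↦ cotDisc w u - c) 0 (Metric.ball 0 1) := by
  intro h
  classical
  obtain ⟨hj, hwj⟩ := Nat.find_spec hne
  have hmin : ∀ k, k ≠ 0 → k < Nat.find hne → w k = 0 := fun k hk hlt ↦ by
    by_contra hwk
    exact Nat.find_min hne hlt ⟨hk, hwk⟩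
  set j := Nat.find hne
  have hsum : ∀ u : ℂ, ‖u‖ < 1 → Summable fun k ↦ w k * cotKernel (u ^ k) := fun u hu ↦ by
    refine Summable.of_norm_bounded (hw.mul_right (2 / (1 - ‖u‖))) fun k ↦ ?_
    rw [norm_mul]
    gcongr
    exact norm_cotKernel_pow_le hu le_rfl k
  have hzero : ∀ u : ℂ, ‖u‖ < 1 →
      ∑' k, w k * (cotKernel (u ^ k) - cotKernel (0 ^ k)) / u ^ j = 0 := fun u hu ↦ by
    have h1 := h (mem_ball_zero_iff.mpr hu)
    have h2 := h (Metric.mem_ball_self (x := (0 : ℂ)) one_pos)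
    simp only [Pi.zero_apply, sub_eq_zero] at h1 h2
    rw [tsum_div_const]
    simp only [mul_sub]
    rw [(hsum u hu).tsum_sub (hsum 0 (by simp))]
    change (cotDisc w u - cotDisc w 0) / u ^ j = 0
    rw [h1, h2, sub_self, zero_div]
  have hlim : Tendsto (fun u : ℂ ↦ ∑' k, w k * (cotKernel (u ^ k) - cotKernel (0 ^ k)) / u ^ j)
      (𝓝[≠] 0) (𝓝 (∑' k, if k = j then -2 * Complex.I * w j else 0)) := by
    have hev : ∀ᶠ u : ℂ in 𝓝[≠] 0, u ≠ 0 ∧ ‖u‖ ≤ 1 / 2 := by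
      refine eventually_mem_nhdsWithin.and (nhdsWithin_le_nhds ?_)
      filter_upwards [Metric.closedBall_mem_nhds (0 : ℂ) (by norm_num : (0 : ℝ) < 1 / 2)] with u hu
      simpa using hu
    have hform : ∀ u : ℂ, u ≠ 0 → ‖u‖ ≤ 1 / 2 → ∀ k, j ≤ k →
        w k * (cotKernel (u ^ k) - cotKernel (0 ^ k)) / u ^ j =
          -2 * Complex.I * w k * (u ^ k / (1 - u ^ k) / u ^ j) := fun u hu0 hu k hk ↦ by
      have hk0 : k ≠ 0 := by omega
      rw [zero_pow hk0, cotKernel_sub_cotKernel_zero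
        (pow_ne_one_of_norm_lt (by linarith) hk0)]
      ring
    have hsmall : ∀ u : ℂ, ∀ k, k < j →
        w k * (cotKernel (u ^ k) - cotKernel (0 ^ k)) / u ^ j = 0 := fun u k hk ↦ by
      rcases eq_or_ne k 0 with rfl | hk0
      · simp
      · simp [hmin k hk0 hk]
    refine tendsto_tsum_of_dominated_convergence (hw.mul_left 4) (fun k ↦ ?_) ?_
    · rcases lt_or_ge k j with hk | hk
      · simp only [hsmall _ k hk, if_neg hk.ne]
        exact tendsto_const_nhds
      · have hc : Tendsto (fun u : ℂ ↦ -2 * Complex.I * w k * (u ^ (k - j) / (1 - u ^ k))) (𝓝[≠] 0)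
            (𝓝 (-2 * Complex.I * w k * (0 ^ (k - j) / (1 - 0 ^ k)))) := by
          refine (ContinuousAt.tendsto ?_).mono_left nhdsWithin_le_nhds
          have : (1 : ℂ) - 0 ^ k ≠ 0 := by simp [show k ≠ 0 by omega]
          fun_prop (disch := assumption)
        have hval : -2 * Complex.I * w k * (0 ^ (k - j) / (1 - 0 ^ k)) =
            if k = j then -2 * Complex.I * w j else 0 := by
          split_ifs with hkj
          · simp [hkj, hj]
          · rw [zero_pow (by omega)]
            simp
        rw [hval] at hc
        refine hc.congr' ?_
        filter_upwards [hev] with u hu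
        rw [hform u hu.1 hu.2 k hk]
        obtain ⟨m, rfl⟩ := Nat.exists_eq_add_of_le hk
        have := hu.1
        rw [Nat.add_sub_cancel_left, pow_add]
        field_simp
    · filter_upwards [hev] with u hu k
      rcases lt_or_ge k j with hk | hk
      · rw [hsmall u k hk, norm_zero]
        positivity
      · rw [hform u hu.1 hu.2 k hk, norm_mul, norm_mul]
        have := norm_pow_div_one_sub_pow_le hu.1 hu.2 hj hk
        have h2 : ‖(-2 : ℂ) * Complex.I‖ = 2 := by simp
        rw [h2]
        nlinarith [norm_nonneg (w k)]
  rw [tsum_ite_eq] at hlim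
  have hev : ∀ᶠ u : ℂ in 𝓝[≠] 0, (0 : ℂ) =
      ∑' k, w k * (cotKernel (u ^ k) - cotKernel (0 ^ k)) / u ^ j := by
    refine nhdsWithin_le_nhds ?_
    filter_upwards [Metric.ball_mem_nhds (0 : ℂ) one_pos] with u hu
    rw [hzero u (mem_ball_zero_iff.mp hu)]
  have := tendsto_nhds_unique hlim (tendsto_const_nhds.congr' hev)
  simp [hwj] at this

/-- The distribution of a nontrivial cotangent series has no atoms. -/
theorem volume_cotSeries_eq_const {p : ℝ} {w : ℕ → ℂ} (hp0 : 0 < p) (hp : p < 1)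
    (hw : Summable fun k ↦ ‖w k‖ ^ p) (hne : ∃ k, k ≠ 0 ∧ w k ≠ 0) {f : ℝ → ℂ}
    (hf : Measurable f) (hfw : f =ᵐ[volume.restrict (Icc 0 1)] cotSeries w) (c : ℂ) :
    volume {x ∈ Icc (0 : ℝ) 1 | f x = c} = 0 := by
  have hw1 := summable_norm_of_summable_norm_rpow hp0 hp.le hw
  have hΦ : IntegrableOn (fun x ↦ 2 ^ p * cosecSeries p w x + ‖c‖ ^ p) (Icc 0 1) :=
    ((integrableOn_cosecSeries hp0 hp hw).const_mul _).add
      (integrableOn_const (by simp))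
  simp_rw [← sub_eq_zero (b := c)]
  refine volume_radialLimit_eq_zero (g := fun u ↦ cotDisc w u - c)
    ((analyticOnNhd_cotDisc hw1).sub analyticOnNhd_const) (not_eqOn_cotDisc_const hw1 hne c)
    (hf.sub_const c) hp0 hΦ ?_ ?_
  · filter_upwards [hfw, ae_irrational _, ae_summable_cosecAbs hp0 hp hw] with x hx hirr hs
    rw [hx]
    refine (tendsto_cotDisc_circleMap hirr ?_).sub_const c
    have := summable_norm_of_summable_norm_rpow (E := ℝ) hp0 hp.le
      (f := fun k : ℕ ↦ ‖w k‖ * cosecAbs (k * x)) ?_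
    · exact this.of_norm
    · refine hs.congr fun k ↦ ?_
      rw [Real.norm_of_nonneg (mul_nonneg (norm_nonneg _) (cosecAbs_nonneg _)),
        Real.mul_rpow (norm_nonneg _) (cosecAbs_nonneg _)]
  · filter_upwards [ae_irrational _, ae_summable_cosecAbs hp0 hp hw] with x hirr hs r hr hr1
    calc ‖cotDisc w (circleMap 0 r (2 * Real.pi * x)) - c‖ ^ p
        ≤ (‖cotDisc w (circleMap 0 r (2 * Real.pi * x))‖ + ‖c‖) ^ p := by
          gcongr
          exact norm_sub_le _ _
      _ ≤ ‖cotDisc w (circleMap 0 r (2 * Real.pi * x))‖ ^ p + ‖c‖ ^ p :=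
          Real.rpow_add_le_add_rpow (norm_nonneg _) (norm_nonneg _) hp0.le hp.le
      _ ≤ _ := by
          gcongr
          exact norm_cotDisc_circleMap_rpow_le hp0 hp.le hirr (by linarith) hr1.le hs

lemma exists_summable_norm_natCast_cpow_rpow {a : ℂ} (ha : a.re < -1) :
    ∃ p : ℝ, 0 < p ∧ p < 1 ∧ Summable fun k : ℕ ↦ ‖(k : ℂ) ^ a‖ ^ p := by
  obtain ⟨p, hp1, hp⟩ := exists_between
    (show (-a.re)⁻¹ < 1 from inv_lt_one_of_one_lt₀ (by linarith))
  have hp0 : 0 < p := (inv_pos.mpr (by linarith)).trans hp1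
  refine ⟨p, hp0, hp, (Real.summable_nat_rpow (p := a.re * p).mpr ?_).congr fun k ↦ ?_⟩
  · rw [inv_lt_iff_one_lt_mul₀ (by linarith)] at hp1
    linarith
  · rw [Complex.norm_natCast_cpow_of_re_ne_zero k (by linarith), ← Real.rpow_mul k.cast_nonneg]

lemma natCast_cpow_eq_ofReal {a : ℂ} (ha : a.im = 0) (k : ℕ) :
    (k : ℂ) ^ a = (((k : ℝ) ^ a.re : ℝ) : ℂ) := by
  rw [Complex.ofReal_cpow k.cast_nonneg, Complex.ofReal_natCast,
    show (a.re : ℂ) = a from Complex.ext rfl (by simp [ha])]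

lemma cotSeries_im_eq_zero {w : ℕ → ℂ} (hw : ∀ k, (w k).im = 0) (x : ℝ) :
    (cotSeries w x).im = 0 := by
  have : cotSeries w x = ((∑' k : ℕ, (w k).re * Real.cot (Real.pi * (k * x)) : ℝ) : ℂ) := by
    rw [cotSeries, Complex.ofReal_tsum]
    refine tsum_congr fun k ↦ ?_
    rw [Complex.ofReal_mul, show ((w k).re : ℂ) = w k from Complex.ext rfl (by simp [hw k])]
  rw [this, Complex.ofReal_im]

/-- If `Im a ≠ 0`, the numbers `1`, `2 ^ a`, `3 ^ a` do not lie on a common real line through the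
origin. -/
lemma exists_linearMap_natCast_cpow_ne_zero {a : ℂ} (ha : a.im ≠ 0) {φ : ℂ →ₗ[ℝ] ℝ} (hφ : φ ≠ 0) :
    ∃ k : ℕ, k ≠ 0 ∧ φ ((k : ℂ) ^ a) ≠ 0 := by
  by_contra! h
  have h1 : φ 1 = 0 := by simpa using h 1 one_ne_zero
  have hz : ∀ z : ℂ, φ z = z.im * φ Complex.I := fun z ↦ by
    conv_lhs => rw [← Complex.re_add_im z]
    rw [map_add, show (z.re : ℂ) = z.re • (1 : ℂ) by simp,
      show (z.im : ℂ) * Complex.I = z.im • Complex.I by simp, map_smul, map_smul, h1]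
    simp
  have hI : φ Complex.I ≠ 0 := fun hI ↦ hφ (LinearMap.ext fun z ↦ by simp [hz z, hI])
  have hlog : ∀ k : ℕ, k ≠ 0 → ∃ n : ℤ, (n : ℝ) * Real.pi = a.im * Real.log k := fun k hk ↦ by
    have hk' := h k hk
    rw [hz, mul_eq_zero, or_iff_left hI, Complex.cpow_def_of_ne_zero (by exact_mod_cast hk),
      ← Complex.natCast_log, Complex.exp_im, mul_eq_zero, or_iff_right (Real.exp_ne_zero _),
      Real.sin_eq_zero_iff] at hk'
    obtain ⟨n, hn⟩ := hk'
    exact ⟨n, by rw [hn, Complex.im_ofReal_mul, mul_comm]⟩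
  obtain ⟨m, hm⟩ := hlog 2 two_ne_zero
  obtain ⟨n, hn⟩ := hlog 3 three_ne_zero
  have h2 : 0 < Real.log (2 : ℕ) := Real.log_pos (by norm_num)
  have hm0 : m ≠ 0 := by
    rintro rfl
    rw [Int.cast_zero, zero_mul] at hm
    exact mul_ne_zero ha h2.ne' hm.symm
  have hmn : (n : ℝ) * Real.log (2 : ℕ) = m * Real.log (3 : ℕ) := by
    refine mul_right_cancel₀ (mul_ne_zero Real.pi_ne_zero ha) ?_
    linear_combination a.im * Real.log (2 : ℕ) * hn - a.im * Real.log (3 : ℕ) * hm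
  have hpow : (2 : ℝ) ^ n.natAbs = 3 ^ m.natAbs := by
    have habs := congrArg abs hmn
    rw [abs_mul, abs_mul, abs_of_pos h2, abs_of_pos (Real.log_pos (by norm_num))] at habs
    refine Real.log_injOn_pos (Set.mem_Ioi.mpr (by positivity)) (Set.mem_Ioi.mpr (by positivity)) ?_
    rw [Real.log_pow, Real.log_pow]
    simpa [Nat.cast_natAbs] using habs
  have hpow' : 2 ^ n.natAbs = 3 ^ m.natAbs := by exact_mod_cast hpow
  have hodd : Odd (3 ^ m.natAbs) := (by decide : Odd 3).pow
  have hn0 : n.natAbs = 0 := by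
    by_contra hn0
    rw [← hpow'] at hodd
    exact (Nat.not_even_iff_odd.mpr hodd) (even_two.pow_of_ne_zero hn0)
  rw [hn0, pow_zero, eq_comm, Nat.pow_eq_one] at hpow'
  omega

lemma cotanSum_eq_cotSeries_of_coprime {a : ℂ} (ha : a.re < -1) {b q : ℕ} (hq : q ≠ 0)
    (hb : b ∈ (Finset.Icc 1 q).filter fun b ↦ Nat.Coprime b q) :
    cotanSum a b q = cotSeries (fun k ↦ (k : ℂ) ^ a) (b / q) := by
  obtain ⟨p, hp0, hp, hw⟩ := exists_summable_norm_natCast_cpow_rpow ha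
  obtain ⟨C, -, hC⟩ := exists_sum_coprime_cosecSeries_le hp0 hp
  exact cotanSum_eq_cotSeries hq
    (summable_norm_mul_cot hp0 hp.le ((hC _ hw q hq).1 b hb)).of_norm

/-- For `Re a < -1`, the values `c_a(b/q)`, `(b,q) = 1`, have a limiting
distribution as `q → ∞`, given by a measurable function `F` on `[0,1]`; the limiting
measure is real and diffuse when `a ∈ ℝ`, and has diffuse pushforwards under every
nonzero `ℝ`-linear form when `a ∉ ℝ`. -/
theorem stmt19 (a : ℂ) (ha : a.re < -1) :
    ∃ F : ℝ → ℂ, Measurable F ∧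
      -- (a) equidistribution of the values `c_a(b/q)`
      (∀ G : ℂ → ℝ, Continuous G → (∃ M : ℝ, ∀ z : ℂ, |G z| ≤ M) →
        Tendsto (fun q : ℕ =>
            (∑ b ∈ (Finset.Icc 1 q).filter fun b => Nat.Coprime b q, G (cotanSum a b q))
              / (q.totient : ℝ))
          atTop (nhds (∫ x in Set.Icc (0 : ℝ) 1, G (F x)))) ∧
      -- (b) the real case
      (a.im = 0 →
        (∀ᵐ x ∂volume.restrict (Set.Icc (0 : ℝ) 1), (F x).im = 0) ∧
        (∀ c : ℂ, volume {x ∈ Set.Icc (0 : ℝ) 1 | F x = c} = 0)) ∧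
      -- (c) the non-real case
      (a.im ≠ 0 →
        ∀ φ : ℂ →ₗ[ℝ] ℝ, φ ≠ 0 → ∀ c : ℝ,
          volume {x ∈ Set.Icc (0 : ℝ) 1 | φ (F x) = c} = 0) := by
  obtain ⟨p, hp0, hp, hw⟩ := exists_summable_norm_natCast_cpow_rpow ha
  have hae := aemeasurable_cotSeries hp0 hp hw
  refine ⟨hae.mk _, hae.measurable_mk, fun G hG ⟨M, hM⟩ ↦ ?_, fun ha0 ↦ ⟨?_, fun c ↦ ?_⟩,
    fun ha0 φ hφ c ↦ ?_⟩
  · have hF : ∫ x in Icc (0 : ℝ) 1, G (hae.mk _ x) =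
        ∫ x in Icc (0 : ℝ) 1, G (cotSeries (fun k ↦ (k : ℂ) ^ a) x) :=
      integral_congr_ae (hae.ae_eq_mk.symm.fun_comp G)
    rw [hF]
    refine (tendsto_average_coprime_comp_cotSeries hp0 hp hw hG hM).congr' ?_
    filter_upwards [eventually_ne_atTop 0] with q hq
    congr 1
    exact Finset.sum_congr rfl fun b hb ↦ by rw [cotanSum_eq_cotSeries_of_coprime ha hq hb]
  · filter_upwards [hae.ae_eq_mk] with x hx
    rw [← hx]
    exact cotSeries_im_eq_zero (fun k ↦ by rw [natCast_cpow_eq_ofReal ha0, Complex.ofReal_im]) x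
  · exact volume_cotSeries_eq_const hp0 hp hw ⟨1, one_ne_zero, by simp⟩ hae.measurable_mk
      hae.ae_eq_mk.symm c
  · let ψ : ℂ →L[ℝ] ℝ := LinearMap.toContinuousLinearMap φ
    have hψ : Summable fun k : ℕ ↦ ‖((φ ((k : ℂ) ^ a) : ℝ) : ℂ)‖ ^ p := by
      refine (hw.mul_left (‖ψ‖ ^ p)).of_nonneg_of_le (fun _ ↦ by positivity) fun k ↦ ?_
      rw [Complex.norm_real, ← Real.mul_rpow (norm_nonneg _) (norm_nonneg _)]
      gcongr
      exact ψ.le_opNorm _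
    obtain ⟨k, hk, hφk⟩ := exists_linearMap_natCast_cpow_ne_zero ha0 hφ
    have hmeas : Measurable fun x ↦ ((φ (hae.mk _ x) : ℝ) : ℂ) :=
      Complex.measurable_ofReal.comp (ψ.continuous.measurable.comp hae.measurable_mk)
    have := volume_cotSeries_eq_const hp0 hp hψ ⟨k, hk, by exact_mod_cast hφk⟩ hmeas ?_ c
    · simpa only [Complex.ofReal_inj] using this
    · filter_upwards [hae.ae_eq_mk, ae_summable_cosecAbs hp0 hp hw] with x hx hs
      have hsum := (summable_norm_mul_cot hp0 hp.le hs).of_norm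
      rw [← hx, cotSeries, cotSeries]
      change ((ψ _ : ℝ) : ℂ) = _
      rw [ψ.map_tsum hsum, Complex.ofReal_tsum]
      refine tsum_congr fun k ↦ ?_
      rw [mul_comm, ← Complex.real_smul, map_smul, smul_eq_mul, Complex.ofReal_mul, mul_comm]
      rfl
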